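/- Let μ ⊢ n, λ ⊨ n, and let A be a row-standard μ-tableau of type λ. Then the homomorphism φ̂_A : S^μ → M^λ lies in the 𝔽-linear span of the set {φ̂_B : B a semistandard μ-tableau of type λ}. -/

import Mathlib

open scoped Classical

noncomputable section

namespace FayersSemistd

/-- The value at `q` of the Gaussian (quantum) binomial coefficient polynomial
`[a choose b]`, defined via the `q`-Pascal recurrence. -/
def qBinom {F : Type*} [Field F] (q : F) : ℕ → ℕ → F
  | _, 0 => 1
  | 0, _+1 => 0
  | a+1, b+1 => qBinom q a b + q ^ (b+1) * qBinom q a (b+1)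

/-- `∏_i [A_i + B_i choose A_i]_q`, where `A_i`, `B_i` are multiplicities in the
multisets `A` and `B`. -/
def qBinomProd {F : Type*} [Field F] (q : F) (A B : Multiset ℕ) : F :=
  ∏ i ∈ (A + B).toFinset, qBinom q ((A + B).count i) (A.count i)

/-- `∑_{i<j} A_j * B_i` : the number of pairs `(x,y)` with `x ∈ A`, `y ∈ B`, `y < x`,
counted with multiplicity. -/
def invPairs (A B : Multiset ℕ) : ℕ :=
  ((A.product B).filter (fun p => p.2 < p.1)).card

/-- The Coxeter length of a permutation of `{0,…,n-1}`: its number of inversions. -/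
def permLength {n : ℕ} (w : Equiv.Perm (Fin n)) : ℕ :=
  (Finset.univ.filter (fun p : Fin n × Fin n => p.1 < p.2 ∧ w p.2 < w p.1)).card

/-- `λ_0 + ⋯ + λ_{r-1}`. -/
def cumSum (lam : ℕ → ℕ) (r : ℕ) : ℕ := ∑ i ∈ Finset.range r, lam i

/-- The (0-indexed) row of the diagram of `λ` containing the (0-indexed) position `p`,
when positions are listed row by row. -/
def rowOf (lam : ℕ → ℕ) (p : ℕ) : ℕ := sInf {r | p < cumSum lam (r+1)}

/-- `λ` is a composition of `n`: finitely many nonzero parts, summing to `n`. -/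
def IsComposition (n : ℕ) (lam : ℕ → ℕ) : Prop :=
  ∃ N, (∀ r, N ≤ r → lam r = 0) ∧ cumSum lam N = n

/-- `μ` is a partition of `n`. -/
def IsPartition (n : ℕ) (mu : ℕ → ℕ) : Prop := IsComposition n mu ∧ Antitone mu

/-- The conjugate partition (0-indexed): `conjP μ i = #{r | μ r > i}`. -/
def conjP (mu : ℕ → ℕ) (i : ℕ) : ℕ := sInf {r | mu r ≤ i}

/-- The standard Young subgroup `W_λ` of `S_n` (as a set): the permutations preserving
each consecutive block of sizes `λ_0, λ_1, …`. -/
def youngW {n : ℕ} (lam : ℕ → ℕ) : Set (Equiv.Perm (Fin n)) :=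
  {w | ∀ p : Fin n, rowOf lam ((w p : Fin n) : ℕ) = rowOf lam (p : ℕ)}

/-- The adjacent transposition `(i, i+1)` (0-indexed) in `S_n`. -/
def adjT {n : ℕ} (i : ℕ) (h : i + 1 < n) : Equiv.Perm (Fin n) :=
  Equiv.swap ⟨i, Nat.lt_of_succ_lt h⟩ ⟨i+1, h⟩

/-- `T : S_n → H` is the standard basis of an Iwahori–Hecke algebra of `S_n` over `F`
with parameter `q`.  Permutations act on the right, so the product `w·s` of the paper
is `s * w` in Mathlib's convention; the multiplication rule
`T_w T_s = T_{ws}` (length increasing) resp. `T_w T_s = q T_{ws} + (q-1) T_w`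
(length decreasing) determines the algebra structure on the basis. -/
structure IsHeckeBasis {F : Type*} [Field F] {H : Type*} [Ring H] [Algebra F H] {n : ℕ}
    (q : F) (T : Equiv.Perm (Fin n) → H) : Prop where
  li : LinearIndependent F T
  total : Submodule.span F (Set.range T) = ⊤
  one : T 1 = 1
  mul_adj_asc : ∀ (w : Equiv.Perm (Fin n)) (i : ℕ) (h : i + 1 < n),
    permLength w < permLength (adjT i h * w) →
    T w * T (adjT i h) = T (adjT i h * w)
  mul_adj_desc : ∀ (w : Equiv.Perm (Fin n)) (i : ℕ) (h : i + 1 < n),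
    permLength (adjT i h * w) < permLength w →
    T w * T (adjT i h) = q • T (adjT i h * w) + (q - 1) • T w

variable {F : Type*} [Field F] {H : Type*} [Ring H] [Algebra F H] {n : ℕ}

/-- `x_λ = ∑_{w ∈ W_λ} T_w`. -/
def xElt (T : Equiv.Perm (Fin n) → H) (lam : ℕ → ℕ) : H :=
  ∑ w ∈ Finset.univ.filter (· ∈ youngW lam), T w

/-- `y_λ = ∑_{w ∈ W_λ} (-q)^{-l(w)} T_w`. -/
def yElt (q : F) (T : Equiv.Perm (Fin n) → H) (lam : ℕ → ℕ) : H :=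
  ∑ w ∈ Finset.univ.filter (· ∈ youngW lam), ((-q)⁻¹) ^ permLength w • T w

/-- The double coset `W_λ d W_μ` (paper convention: maps act on the right, so the
paper product `u·d·v` is `v * d * u` in Mathlib's convention). -/
def doubleCoset {n : ℕ} (lam mu : ℕ → ℕ) (d : Equiv.Perm (Fin n)) :
    Set (Equiv.Perm (Fin n)) :=
  {w | ∃ u ∈ youngW (n := n) lam, ∃ v ∈ youngW (n := n) mu, w = v * d * u}

/-- `∑_{w ∈ W_λ 1_A W_μ} T_w`, the image `x_μ φ_A` of `x_μ` under the tableau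
homomorphism `φ_A : M^μ → M^λ`, where `d = 1_A`. -/
def XPhi (T : Equiv.Perm (Fin n) → H) (lam mu : ℕ → ℕ) (d : Equiv.Perm (Fin n)) : H :=
  ∑ w ∈ Finset.univ.filter (· ∈ doubleCoset lam mu d), T w

/-- A row-standard tableau is recorded by the multisets of entries of its rows; it has
shape `μ` when row `r` has `μ_r` entries. -/
def RowsOfShape (mu : ℕ → ℕ) (A : ℕ → Multiset ℕ) : Prop := ∀ r, (A r).card = mu r

/-- The tableau with rows `A 0, A 1, …` has type `λ` when the entry `v` occurs `λ_v`
times in total (entries and types are 0-indexed). -/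
def HasType (A : ℕ → Multiset ℕ) (lam : ℕ → ℕ) : Prop :=
  ∀ v, (∑ᶠ r, (A r).count v) = lam v

/-- The entry in row `r`, column `c` (0-indexed) of the row-standard tableau with row
multisets `A`. -/
def entryAt (A : ℕ → Multiset ℕ) (r c : ℕ) : ℕ := ((A r).sort (· ≤ ·)).getD c 0

/-- `d = 1_A` for the row-standard `μ`-tableau `A` of type `λ`: the tableau `t^λ d`
(whose entry at position `p` is `d p`) is row-standard (first clause), and the entry
`d p` lies in row `r` of `t^λ d` exactly when the position occupied by `d p` in `t^μ`
is occupied by `r` in `A` (second clause). -/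
def Is1A {n : ℕ} (mu lam : ℕ → ℕ) (A : ℕ → Multiset ℕ) (d : Equiv.Perm (Fin n)) : Prop :=
  (∀ p p' : Fin n, rowOf lam (p : ℕ) = rowOf lam (p' : ℕ) → p < p' → d p < d p') ∧
  (∀ p : Fin n,
    entryAt A (rowOf mu ((d p : Fin n) : ℕ))
      (((d p : Fin n) : ℕ) - cumSum mu (rowOf mu ((d p : Fin n) : ℕ)))
      = rowOf lam (p : ℕ))

/-- A row-standard tableau is semistandard if its columns are strictly increasing. -/
def Semistandard (mu : ℕ → ℕ) (A : ℕ → Multiset ℕ) : Prop :=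
  ∀ r c, c < mu (r+1) → entryAt A r c < entryAt A (r+1) c

/-- The (0-indexed) column of the position `p` in the diagram of `μ`. -/
def colIdx (mu : ℕ → ℕ) (p : ℕ) : ℕ := p - cumSum mu (rowOf mu p)

/-- `w = w_μ`, i.e. `t^μ w = t_μ`: the image of position `p` is the number of positions
coming strictly before `p` in the column-reading order of the diagram of `μ`. -/
def IsWmu {n : ℕ} (mu : ℕ → ℕ) (w : Equiv.Perm (Fin n)) : Prop :=
  ∀ p : Fin n, ((w p : Fin n) : ℕ) = (Finset.univ.filter (fun p' : Fin n =>
    colIdx mu (p' : ℕ) < colIdx mu (p : ℕ) ∨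
      (colIdx mu (p' : ℕ) = colIdx mu (p : ℕ) ∧ rowOf mu (p' : ℕ) < rowOf mu (p : ℕ)))).card

def comp1 (a : ℕ) : ℕ → ℕ := fun r => if r = 0 then a else 0
def comp2 (a b : ℕ) : ℕ → ℕ := fun r => if r = 0 then a else if r = 1 then b else 0
def comp3 (a b c : ℕ) : ℕ → ℕ :=
  fun r => if r = 0 then a else if r = 1 then b else if r = 2 then c else 0
def comp4 (a b c d : ℕ) : ℕ → ℕ :=
  fun r => if r = 0 then a else if r = 1 then b else if r = 2 then c else if r = 3 then d else 0
def rows1 (a : Multiset ℕ) : ℕ → Multiset ℕ := fun r => if r = 0 then a else 0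
def rows2 (a b : Multiset ℕ) : ℕ → Multiset ℕ :=
  fun r => if r = 0 then a else if r = 1 then b else 0
def rows3 (a b c : Multiset ℕ) : ℕ → Multiset ℕ :=
  fun r => if r = 0 then a else if r = 1 then b else if r = 2 then c else 0
def rows4 (a b c d : Multiset ℕ) : ℕ → Multiset ℕ :=
  fun r => if r = 0 then a else if r = 1 then b else if r = 2 then c else if r = 3 then d else 0

end FayersSemistd
namespace FayersSemistd

section Inversions

variable {m : ℕ}

theorem perm_apply_inv (w : Equiv.Perm (Fin m)) (x : Fin m) : w (w⁻¹ x) = x :=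
  w.apply_symm_apply x

theorem perm_inv_apply (w : Equiv.Perm (Fin m)) (x : Fin m) : w⁻¹ (w x) = x :=
  w.symm_apply_apply x

theorem permLength_one : permLength (1 : Equiv.Perm (Fin m)) = 0 := by
  unfold permLength
  rw [Finset.card_eq_zero, Finset.filter_eq_empty_iff]
  rintro ⟨a, b⟩ - ⟨h1, h2⟩
  exact absurd h1 (not_lt.2 (le_of_lt h2))

theorem adjT_mul_self {i : ℕ} (h : i + 1 < m) : adjT i h * adjT i h = 1 :=
  Equiv.swap_mul_self _ _

theorem adjT_mul_cancel {i : ℕ} (h : i + 1 < m) (w : Equiv.Perm (Fin m)) :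
    adjT i h * (adjT i h * w) = w := by
  rw [← mul_assoc, adjT_mul_self, one_mul]

theorem mul_adjT_cancel {i : ℕ} (h : i + 1 < m) (w : Equiv.Perm (Fin m)) :
    w * adjT i h * adjT i h = w := by
  rw [mul_assoc, adjT_mul_self, mul_one]

theorem adjT_inv {i : ℕ} (h : i + 1 < m) : (adjT i h)⁻¹ = adjT i h :=
  Equiv.swap_inv _ _

theorem adjT_val {i : ℕ} (h : i + 1 < m) (x : Fin m) :
    ((adjT i h x : Fin m) : ℕ) =
      if (x : ℕ) = i then i + 1 else if (x : ℕ) = i + 1 then i else x := by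
  unfold adjT
  rw [Equiv.swap_apply_def]
  simp only [Fin.ext_iff]
  split_ifs <;> rfl

theorem permLength_inv (w : Equiv.Perm (Fin m)) : permLength w⁻¹ = permLength w := by
  unfold permLength
  refine Finset.card_bij' (fun p _ => (w⁻¹ p.2, w⁻¹ p.1)) (fun p _ => (w p.2, w p.1)) ?_ ?_ ?_ ?_
  · rintro ⟨a, b⟩ h
    simp only [Finset.mem_filter, Finset.mem_univ, true_and] at h ⊢
    simpa using ⟨h.2, h.1⟩
  · rintro ⟨a, b⟩ h
    simp only [Finset.mem_filter, Finset.mem_univ, true_and] at h ⊢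
    simpa using ⟨h.2, h.1⟩
  · rintro ⟨a, b⟩ h
    simp
  · rintro ⟨a, b⟩ h
    simp

theorem permLength_adjT_mul {i : ℕ} (h : i + 1 < m) (w : Equiv.Perm (Fin m))
    (hw : w⁻¹ ⟨i, Nat.lt_of_succ_lt h⟩ < w⁻¹ ⟨i + 1, h⟩) :
    permLength (adjT i h * w) = permLength w + 1 := by
  unfold permLength
  have key : (Finset.univ.filter (fun p : Fin m × Fin m => p.1 < p.2 ∧
      (adjT i h * w) p.2 < (adjT i h * w) p.1)) =
      insert (w⁻¹ ⟨i, Nat.lt_of_succ_lt h⟩, w⁻¹ ⟨i + 1, h⟩)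
        (Finset.univ.filter (fun p : Fin m × Fin m => p.1 < p.2 ∧ w p.2 < w p.1)) := by
    ext ⟨a, b⟩
    obtain ⟨a, rfl⟩ := w⁻¹.surjective a
    obtain ⟨b, rfl⟩ := w⁻¹.surjective b
    rw [Finset.mem_insert, Finset.mem_filter, Finset.mem_filter]
    simp only [Finset.mem_univ, true_and, Prod.mk.injEq,
      Equiv.Perm.mul_apply, perm_apply_inv, EmbeddingLike.apply_eq_iff_eq]
    have ha := adjT_val h a
    have hb := adjT_val h b
    rw [Fin.lt_def (a := adjT i h b), Fin.lt_def (a := b), ha, hb]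
    have hba : ∀ (hab : (a : ℕ) = i + 1 ∧ (b : ℕ) = i), ¬ w⁻¹ a < w⁻¹ b := by
      rintro ⟨h1, h2⟩
      have e1 : a = ⟨i + 1, h⟩ := Fin.ext h1
      have e2 : b = ⟨i, Nat.lt_of_succ_lt h⟩ := Fin.ext h2
      rw [e1, e2]
      exact not_lt.2 hw.le
    have hab : ((a : ℕ) = i ∧ (b : ℕ) = i + 1) → w⁻¹ a < w⁻¹ b := by
      rintro ⟨h1, h2⟩
      have e1 : b = ⟨i + 1, h⟩ := Fin.ext h2
      have e2 : a = ⟨i, Nat.lt_of_succ_lt h⟩ := Fin.ext h1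
      rw [e1, e2]
      exact hw
    have e3 : (a = ⟨i, Nat.lt_of_succ_lt h⟩) ↔ (a : ℕ) = i := Fin.ext_iff
    have e4 : (b = ⟨i + 1, h⟩) ↔ (b : ℕ) = i + 1 := Fin.ext_iff
    rw [e3, e4]
    by_cases hlt : w⁻¹ a < w⁻¹ b
    · simp only [hlt, true_and]
      have : ¬ ((a : ℕ) = i + 1 ∧ (b : ℕ) = i) := fun h => hba h hlt
      have hne : (a : ℕ) ≠ b := fun h => by
        rw [Fin.ext h] at hlt
        exact lt_irrefl _ hlt
      split_ifs <;> omega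
    · simp only [hlt, false_and, or_false, false_iff]
      exact fun h => hlt (hab h)
  rw [key, Finset.card_insert_of_notMem]
  simp only [Finset.mem_filter, Finset.mem_univ, true_and, perm_apply_inv, not_and]
  intro _
  simp [Fin.lt_def]

theorem permLength_adjT_mul_of_gt {i : ℕ} (h : i + 1 < m) (w : Equiv.Perm (Fin m))
    (hw : w⁻¹ ⟨i + 1, h⟩ < w⁻¹ ⟨i, Nat.lt_of_succ_lt h⟩) :
    permLength w = permLength (adjT i h * w) + 1 := by
  conv_lhs => rw [← adjT_mul_cancel h w]
  apply permLength_adjT_mul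
  simpa [mul_inv_rev, adjT_inv, adjT] using hw

theorem permLength_mul_adjT {i : ℕ} (h : i + 1 < m) (w : Equiv.Perm (Fin m))
    (hw : w ⟨i, Nat.lt_of_succ_lt h⟩ < w ⟨i + 1, h⟩) :
    permLength (w * adjT i h) = permLength w + 1 := by
  rw [← permLength_inv, ← permLength_inv w, mul_inv_rev, adjT_inv]
  apply permLength_adjT_mul
  simpa using hw

theorem permLength_mul_adjT_of_gt {i : ℕ} (h : i + 1 < m) (w : Equiv.Perm (Fin m))
    (hw : w ⟨i + 1, h⟩ < w ⟨i, Nat.lt_of_succ_lt h⟩) :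
    permLength w = permLength (w * adjT i h) + 1 := by
  rw [← permLength_inv, ← permLength_inv (w * _), mul_inv_rev, adjT_inv]
  apply permLength_adjT_mul_of_gt
  simpa using hw

theorem inv_lt_or_gt (w : Equiv.Perm (Fin m)) {i : ℕ} (h : i + 1 < m) :
    w⁻¹ ⟨i, Nat.lt_of_succ_lt h⟩ < w⁻¹ ⟨i + 1, h⟩ ∨
      w⁻¹ ⟨i + 1, h⟩ < w⁻¹ ⟨i, Nat.lt_of_succ_lt h⟩ := by
  apply lt_or_gt_of_ne
  simp

theorem lt_permLength_adjT_mul_iff {i : ℕ} (h : i + 1 < m) (w : Equiv.Perm (Fin m)) :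
    permLength w < permLength (adjT i h * w) ↔
      w⁻¹ ⟨i, Nat.lt_of_succ_lt h⟩ < w⁻¹ ⟨i + 1, h⟩ := by
  rcases inv_lt_or_gt w h with h1 | h1
  · exact iff_of_true (by rw [permLength_adjT_mul h w h1]; omega) h1
  · have := permLength_adjT_mul_of_gt h w h1
    constructor
    · intro h2; omega
    · intro h2; exact absurd h1 (not_lt.2 h2.le)

/-- A permutation without inversions between neighbours is the identity. -/
theorem eq_one_of_forall_lt (w : Equiv.Perm (Fin m))
    (hw : ∀ (i : ℕ) (h : i + 1 < m), w ⟨i, Nat.lt_of_succ_lt h⟩ < w ⟨i + 1, h⟩) : w = 1 := by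
  have hmono : StrictMono w := by
    cases m with
    | zero => exact fun a => a.elim0
    | succ k =>
      rw [Fin.strictMono_iff_lt_succ]
      intro i
      exact hw i (by omega)
  have h2 : ⇑w = ⇑(1 : Equiv.Perm (Fin m)) := by
    have := (StrictMono.range_inj hmono (g := id) strictMono_id).1 (by simp)
    simpa using this
  exact Equiv.coe_fn_injective h2

theorem exists_inv_gt_of_ne_one (w : Equiv.Perm (Fin m)) (hw : w ≠ 1) :
    ∃ (i : ℕ) (h : i + 1 < m), w⁻¹ ⟨i + 1, h⟩ < w⁻¹ ⟨i, Nat.lt_of_succ_lt h⟩ := by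
  by_contra hcon
  push Not at hcon
  apply hw
  have := eq_one_of_forall_lt w⁻¹ (fun i h => lt_of_le_of_ne (hcon i h) (by simp))
  simpa using this

end Inversions

section Hecke

variable {F : Type*} [Field F] {H : Type*} [Ring H] [Algebra F H] {n : ℕ} {q : F}
  {T : Equiv.Perm (Fin n) → H}

theorem T_mul_asc (hT : IsHeckeBasis q T) (w : Equiv.Perm (Fin n)) {i : ℕ} (h : i + 1 < n)
    (hw : w⁻¹ ⟨i, Nat.lt_of_succ_lt h⟩ < w⁻¹ ⟨i + 1, h⟩) :
    T w * T (adjT i h) = T (adjT i h * w) :=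
  hT.mul_adj_asc w i h ((lt_permLength_adjT_mul_iff h w).2 hw)

theorem T_mul_desc (hT : IsHeckeBasis q T) (w : Equiv.Perm (Fin n)) {i : ℕ} (h : i + 1 < n)
    (hw : w⁻¹ ⟨i + 1, h⟩ < w⁻¹ ⟨i, Nat.lt_of_succ_lt h⟩) :
    T w * T (adjT i h) = q • T (adjT i h * w) + (q - 1) • T w := by
  apply hT.mul_adj_desc w i h
  have := permLength_adjT_mul_of_gt h w hw
  omega

theorem T_adj_sq (hT : IsHeckeBasis q T) {i : ℕ} (h : i + 1 < n) :
    T (adjT i h) * T (adjT i h) = q • (1 : H) + (q - 1) • T (adjT i h) := by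
  rw [T_mul_desc hT, adjT_mul_self, hT.one]
  simp [adjT, Fin.lt_def]

/-- Lengths add under multiplication by `e` when `w⁻¹` preserves the order of every pair
inverted by `e`. -/
theorem T_mul_T (hT : IsHeckeBasis q T) (w : Equiv.Perm (Fin n)) :
    ∀ (l : ℕ) (e : Equiv.Perm (Fin n)), permLength e = l →
      (∀ a b : Fin n, a < b → e b < e a → w⁻¹ a < w⁻¹ b) → T w * T e = T (e * w) := by
  intro l
  induction l with
  | zero =>
    intro e he hinv
    by_cases h1 : e = 1
    · rw [h1, hT.one, mul_one, one_mul]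
    · obtain ⟨i, h, hi⟩ := exists_inv_gt_of_ne_one e h1
      have := permLength_adjT_mul_of_gt h e hi
      omega
  | succ l ih =>
    intro e he hinv
    have h1 : e ≠ 1 := by
      rintro rfl
      rw [permLength_one] at he
      omega
    obtain ⟨i, h, hi⟩ := exists_inv_gt_of_ne_one e h1
    have hl := permLength_adjT_mul_of_gt h e hi
    obtain ⟨e', rfl⟩ : ∃ e', e = adjT i h * e' := ⟨adjT i h * e, (adjT_mul_cancel h e).symm⟩
    rw [adjT_mul_cancel] at hl
    have hi' : e'⁻¹ ⟨i, Nat.lt_of_succ_lt h⟩ < e'⁻¹ ⟨i + 1, h⟩ := by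
      simpa [mul_inv_rev, adjT_inv, adjT] using hi
    have hstep : w⁻¹ (e'⁻¹ ⟨i, Nat.lt_of_succ_lt h⟩) < w⁻¹ (e'⁻¹ ⟨i + 1, h⟩) := by
      apply hinv _ _ hi'
      simp only [Equiv.Perm.mul_apply, perm_apply_inv]
      simp [adjT, Fin.lt_def]
    rw [← T_mul_asc hT e' h hi', ← mul_assoc, ih e' (by omega), T_mul_asc hT, mul_assoc]
    · simpa [mul_inv_rev] using hstep
    · intro a b hab hba
      by_cases hs : (adjT i h * e') b < (adjT i h * e') a
      · exact hinv a b hab hs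
      · have h3 : ((e' a : Fin n) : ℕ) = i + 1 ∧ ((e' b : Fin n) : ℕ) = i := by
          rw [Equiv.Perm.mul_apply, Equiv.Perm.mul_apply, Fin.lt_def, adjT_val, adjT_val] at hs
          rw [Fin.lt_def] at hba
          split_ifs at hs <;> omega
        have ha : e' a = ⟨i + 1, h⟩ := Fin.ext h3.1
        have hb : e' b = ⟨i, Nat.lt_of_succ_lt h⟩ := Fin.ext h3.2
        rw [← ha, ← hb, perm_inv_apply, perm_inv_apply] at hi'
        exact absurd hi' (not_lt.2 hab.le)

theorem T_adj_mul (hT : IsHeckeBasis q T) (w : Equiv.Perm (Fin n)) {i : ℕ} (h : i + 1 < n)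
    (hw : w ⟨i, Nat.lt_of_succ_lt h⟩ < w ⟨i + 1, h⟩) :
    T (adjT i h) * T w = T (w * adjT i h) := by
  refine T_mul_T hT _ _ w rfl ?_
  intro a b hab hba
  rw [adjT_inv, Fin.lt_def, adjT_val, adjT_val]
  have : ¬ ((a : ℕ) = i ∧ (b : ℕ) = i + 1) := by
    rintro ⟨h1, h2⟩
    have ha : a = ⟨i, Nat.lt_of_succ_lt h⟩ := Fin.ext h1
    have hb : b = ⟨i + 1, h⟩ := Fin.ext h2
    rw [ha, hb] at hba
    exact absurd hw (not_lt.2 hba.le)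
  rw [Fin.lt_def] at hab
  split_ifs <;> omega

/-- If `w` maps the neighbours `k, k+1` to the neighbours `j, j+1`, then `T_k T_w = T_w T_j`. -/
theorem T_adj_comm (hT : IsHeckeBasis q T) (w : Equiv.Perm (Fin n)) {k j : ℕ} (hk : k + 1 < n)
    (hj : j + 1 < n) (h1 : w ⟨k, Nat.lt_of_succ_lt hk⟩ = ⟨j, Nat.lt_of_succ_lt hj⟩)
    (h2 : w ⟨k + 1, hk⟩ = ⟨j + 1, hj⟩) :
    T (adjT k hk) * T w = T w * T (adjT j hj) := by
  rw [T_adj_mul hT w hk (by rw [h1, h2]; simp [Fin.lt_def]), T_mul_asc hT w hj]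
  · congr 1
    unfold adjT
    rw [Equiv.mul_swap_eq_swap_mul, h1, h2]
  · rw [← h1, ← h2, perm_inv_apply, perm_inv_apply]
    simp [Fin.lt_def]

/-- A sum of `T_w` over a set stable under left multiplication by a simple transposition is
divisible on the right by `1 + T_k`. -/
theorem exists_eq_mul_one_add (hT : IsHeckeBasis q T) (S : Equiv.Perm (Fin n) → Prop) {k : ℕ}
    (hk : k + 1 < n) (hS : ∀ w, S w → S (adjT k hk * w)) :
    ∃ Q : H, ∑ w ∈ Finset.univ.filter S, T w = Q * (1 + T (adjT k hk)) := by
  set asc : Equiv.Perm (Fin n) → Prop :=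
    fun w => w⁻¹ ⟨k, Nat.lt_of_succ_lt hk⟩ < w⁻¹ ⟨k + 1, hk⟩ with hasc
  have hflip : ∀ w, asc (adjT k hk * w) ↔ ¬ asc w := by
    intro w
    have := inv_lt_or_gt w hk
    simp only [hasc, mul_inv_rev, adjT_inv, Equiv.Perm.mul_apply, not_lt]
    simp only [adjT, Equiv.swap_apply_left, Equiv.swap_apply_right]
    constructor
    · exact le_of_lt
    · intro h
      exact lt_of_le_of_ne h (by simp)
  refine ⟨∑ w ∈ (Finset.univ.filter S).filter asc, T w, ?_⟩
  rw [mul_add, mul_one, ← Finset.sum_filter_add_sum_filter_not (Finset.univ.filter S) asc]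
  congr 1
  rw [Finset.sum_mul]
  refine Finset.sum_bij' (fun w _ => adjT k hk * w) (fun w _ => adjT k hk * w) ?_ ?_ ?_ ?_ ?_
  · intro w hw
    simp only [Finset.mem_filter, Finset.mem_univ, true_and] at hw ⊢
    exact ⟨hS w hw.1, (hflip w).2 hw.2⟩
  · intro w hw
    simp only [Finset.mem_filter, Finset.mem_univ, true_and] at hw ⊢
    refine ⟨hS w hw.1, fun h => (hflip w).1 h hw.2⟩
  · intro w _
    exact adjT_mul_cancel hk w
  · intro w _
    exact adjT_mul_cancel hk w
  · intro w hw
    simp only [Finset.mem_filter, Finset.mem_univ, true_and] at hw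
    rw [T_mul_asc hT _ hk ((hflip w).2 hw.2), adjT_mul_cancel]

theorem one_add_mul_adj (hT : IsHeckeBasis q T) {k : ℕ} (hk : k + 1 < n) :
    (1 + T (adjT k hk)) * T (adjT k hk) = q • (1 + T (adjT k hk)) := by
  rw [add_mul, one_mul, T_adj_sq hT, sub_smul, one_smul, smul_add]
  abel

theorem sum_mul_adj (hT : IsHeckeBasis q T) (S : Equiv.Perm (Fin n) → Prop) {k : ℕ}
    (hk : k + 1 < n) (hS : ∀ w, S w → S (adjT k hk * w)) :
    (∑ w ∈ Finset.univ.filter S, T w) * T (adjT k hk) =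
      q • ∑ w ∈ Finset.univ.filter S, T w := by
  obtain ⟨Q, hQ⟩ := exists_eq_mul_one_add hT S hk hS
  rw [hQ, mul_assoc, one_add_mul_adj hT, mul_smul_comm]

theorem one_add_mul_yElt (hT : IsHeckeBasis q T) (hq : q ≠ 0) (nu : ℕ → ℕ) {k : ℕ}
    (hk : k + 1 < n) (hnu : rowOf nu k = rowOf nu (k + 1)) :
    (1 + T (adjT k hk)) * yElt q T nu = 0 := by
  unfold yElt
  rw [Finset.mul_sum]
  have hpair : ∀ w : Equiv.Perm (Fin n), w ⟨k, Nat.lt_of_succ_lt hk⟩ < w ⟨k + 1, hk⟩ →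
      (1 + T (adjT k hk)) * (((-q)⁻¹) ^ permLength w • T w) +
      (1 + T (adjT k hk)) * (((-q)⁻¹) ^ permLength (w * adjT k hk) • T (w * adjT k hk)) = 0 := by
    intro w hw
    have hz : (1 + T (adjT k hk)) * (1 + (-q)⁻¹ • T (adjT k hk)) = 0 := by
      rw [mul_add, mul_one, mul_smul_comm, one_add_mul_adj hT, smul_smul, inv_neg, neg_mul,
        inv_mul_cancel₀ hq]
      rw [neg_one_smul, add_neg_cancel]
    rw [permLength_mul_adjT hk w hw, ← T_adj_mul hT w hk hw, pow_succ, ← mul_add, mul_smul,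
      ← smul_add]
    have : T w + (-q)⁻¹ • (T (adjT k hk) * T w) = (1 + (-q)⁻¹ • T (adjT k hk)) * T w := by
      rw [add_mul, one_mul, smul_mul_assoc]
    rw [this, mul_smul_comm, ← mul_assoc, hz, zero_mul, smul_zero]
  have hne : ∀ w : Equiv.Perm (Fin n), w * adjT k hk ≠ w := by
    intro w h
    have h2 := congrArg (fun u => u ⟨k, Nat.lt_of_succ_lt hk⟩) h
    simp [adjT] at h2
  refine Finset.sum_involution (fun w _ => w * adjT k hk) ?_ ?_ ?_ ?_
  · intro w _
    rcases lt_or_gt_of_ne (show w ⟨k, Nat.lt_of_succ_lt hk⟩ ≠ w ⟨k + 1, hk⟩ by simp) with h | h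
    · exact hpair w h
    · have := hpair (w * adjT k hk) (by simpa [adjT] using h)
      rw [mul_adjT_cancel] at this
      rw [add_comm]
      exact this
  · intro w _ _
    exact hne w
  · intro w hw
    simp only [Finset.mem_filter, Finset.mem_univ, true_and] at hw ⊢
    intro p
    rw [Equiv.Perm.mul_apply, hw, adjT_val]
    split_ifs with h1 h2
    · rw [h1, hnu]
    · rw [h2, hnu]
    · rfl
  · intro w _
    exact mul_adjT_cancel hk w

end Hecke

section Blocks

variable {m : ℕ} {lam : ℕ → ℕ}

theorem cumSum_succ (lam : ℕ → ℕ) (r : ℕ) : cumSum lam (r + 1) = cumSum lam r + lam r :=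
  Finset.sum_range_succ _ _

theorem cumSum_mono (lam : ℕ → ℕ) : Monotone (cumSum lam) :=
  monotone_nat_of_le_succ fun r => by rw [cumSum_succ]; omega

theorem IsComposition.cumSum_eq (h : IsComposition m lam) : ∃ N, ∀ r, N ≤ r → cumSum lam r = m := by
  obtain ⟨N, h0, hN⟩ := h
  refine ⟨N, fun r hr => ?_⟩
  induction r, hr using Nat.le_induction with
  | base => exact hN
  | succ r hr ih => rw [cumSum_succ, ih, h0 r hr, add_zero]

theorem IsComposition.cumSum_le (h : IsComposition m lam) (r : ℕ) : cumSum lam r ≤ m := by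
  obtain ⟨N, hN⟩ := h.cumSum_eq
  rw [← hN (max N r) (le_max_left _ _)]
  exact cumSum_mono _ (le_max_right _ _)

theorem rowOf_eq_iff (h : IsComposition m lam) {p v : ℕ} (hp : p < m) :
    rowOf lam p = v ↔ cumSum lam v ≤ p ∧ p < cumSum lam (v + 1) := by
  have hne : {r | p < cumSum lam (r + 1)}.Nonempty := by
    obtain ⟨N, hN⟩ := h.cumSum_eq
    exact ⟨N, by simpa [hN (N + 1) (Nat.le_succ N)] using hp⟩
  constructor
  · rintro rfl
    refine ⟨?_, Nat.sInf_mem hne⟩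
    by_contra hcon
    rcases Nat.eq_zero_or_pos (rowOf lam p) with h0 | h0
    · rw [h0] at hcon
      simp [cumSum] at hcon
    · have hmem : rowOf lam p - 1 ∈ {r | p < cumSum lam (r + 1)} := by
        simp only [Set.mem_ofPred_eq, Nat.sub_add_cancel h0]
        omega
      have h1 : rowOf lam p ≤ rowOf lam p - 1 := Nat.sInf_le hmem
      omega
  · rintro ⟨h1, h2⟩
    apply le_antisymm
    · exact Nat.sInf_le h2
    · by_contra hcon
      push Not at hcon
      have h3 : p < cumSum lam (rowOf lam p + 1) := Nat.sInf_mem hne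
      have h4 : cumSum lam (rowOf lam p + 1) ≤ cumSum lam v := cumSum_mono _ hcon
      omega

theorem rowOf_spec (h : IsComposition m lam) {p : ℕ} (hp : p < m) :
    cumSum lam (rowOf lam p) ≤ p ∧ p < cumSum lam (rowOf lam p + 1) :=
  (rowOf_eq_iff h hp).1 rfl

theorem rowOf_mono (h : IsComposition m lam) {p p' : ℕ} (hpp : p ≤ p') (hp : p' < m) :
    rowOf lam p ≤ rowOf lam p' := by
  by_contra hcon
  push Not at hcon
  have h1 := rowOf_spec h (lt_of_le_of_lt hpp hp)
  have h2 := rowOf_spec h hp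
  have h3 : cumSum lam (rowOf lam p' + 1) ≤ cumSum lam (rowOf lam p) := cumSum_mono _ hcon
  omega

theorem card_interval {a b : ℕ} (hb : b ≤ m) :
    (Finset.univ.filter (fun p : Fin m => a ≤ (p : ℕ) ∧ (p : ℕ) < b)).card = b - a := by
  rw [← Nat.card_Ico a b, ← Finset.card_map Fin.valEmbedding]
  congr 1
  ext x
  simp only [Finset.mem_map, Finset.mem_filter, Finset.mem_univ, true_and, Finset.mem_Ico,
    Fin.valEmbedding_apply]
  constructor
  · rintro ⟨p, hp, rfl⟩
    exact hp
  · intro hx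
    exact ⟨⟨x, by omega⟩, hx, rfl⟩

theorem card_rowOf (h : IsComposition m lam) (v : ℕ) :
    (Finset.univ.filter (fun p : Fin m => rowOf lam (p : ℕ) = v)).card = lam v := by
  have h1 := card_interval (m := m) (a := cumSum lam v) (h.cumSum_le (v + 1))
  rw [cumSum_succ, Nat.add_sub_cancel_left] at h1
  rw [← h1, ← cumSum_succ]
  congr 1
  ext p
  simp only [Finset.mem_filter, Finset.mem_univ, true_and]
  exact rowOf_eq_iff h p.2

theorem lt_conjP_iff {mu : ℕ → ℕ} (h : IsPartition m mu) (t j : ℕ) :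
    t < conjP mu j ↔ j < mu t := by
  have hne : {r | mu r ≤ j}.Nonempty := by
    obtain ⟨N, h0, -⟩ := h.1
    exact ⟨N, by simp [h0 N le_rfl]⟩
  constructor
  · intro ht
    by_contra hcon
    exact absurd (Nat.sInf_le (show t ∈ {r | mu r ≤ j} from not_lt.1 hcon)) (not_le.2 ht)
  · intro ht
    by_contra hcon
    have h1 : mu (conjP mu j) ≤ j := Nat.sInf_mem hne
    have h2 := h.2 (not_lt.1 hcon)
    omega

/-- The nodes in the first `s` rows of a partition, counted by columns. -/
theorem sum_min_conjP {mu : ℕ → ℕ} (h : IsPartition m mu) (s : ℕ) :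
    ∑ j ∈ Finset.range (mu 0), min s (conjP mu j) = cumSum mu s := by
  have h1 : ∀ j, min s (conjP mu j) = ∑ t ∈ Finset.range s, if j < mu t then 1 else 0 := by
    intro j
    rw [← Finset.card_filter]
    rw [← Finset.card_range (min s (conjP mu j))]
    congr 1
    ext t
    simp only [Finset.mem_range, lt_min_iff, Finset.mem_filter, lt_conjP_iff h]
  simp only [h1]
  rw [Finset.sum_comm]
  refine Finset.sum_congr rfl fun t _ => ?_
  rw [← Finset.card_filter]
  rw [← Finset.card_range (mu t)]
  congr 1
  ext j
  have := h.2 (Nat.zero_le t)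
  simp only [Finset.mem_filter, Finset.mem_range]
  rw [Finset.card_range]
  omega

theorem conjP_eq_zero {mu : ℕ → ℕ} (h : IsPartition m mu) {j : ℕ} (hj : mu 0 ≤ j) :
    conjP mu j = 0 := by
  by_contra hcon
  have := (lt_conjP_iff h 0 j).1 (Nat.pos_of_ne_zero hcon)
  omega

theorem isComposition_conjP {mu : ℕ → ℕ} (h : IsPartition m mu) :
    IsComposition m (conjP mu) := by
  obtain ⟨N, h0, hN⟩ := h.1
  refine ⟨mu 0, fun j hj => conjP_eq_zero h hj, ?_⟩
  rw [← hN, ← sum_min_conjP h N]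
  refine Finset.sum_congr rfl fun j _ => ?_
  rw [eq_comm, min_eq_right_iff]
  by_contra hcon
  have := (lt_conjP_iff h N j).1 (not_le.1 hcon)
  rw [h0 N le_rfl] at this
  omega

end Blocks

section Vanishing

variable {F : Type*} [Field F] {H : Type*} [Ring H] [Algebra F H] {n : ℕ} {q : F}
  {T : Equiv.Perm (Fin n) → H}

/-- Pigeonhole: blocks too large to meet every column of `μ` at most once must contain two
positions which `w` sends to the same column. -/
theorem exists_lt_same_block {mu : ℕ → ℕ} (hmu : IsPartition n mu) (β : Fin n → ℕ)
    (P : Finset (Fin n)) (s : ℕ) (hs : (P.image β).card ≤ s) (hP : cumSum mu s < P.card)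
    (w : Equiv.Perm (Fin n)) :
    ∃ a b : Fin n, a < b ∧ β a = β b ∧
      rowOf (conjP mu) (w a : ℕ) = rowOf (conjP mu) (w b : ℕ) := by
  by_contra hcon
  push Not at hcon
  have hc := isComposition_conjP hmu
  have hinj : ∀ a b : Fin n, β a = β b →
      rowOf (conjP mu) (w a : ℕ) = rowOf (conjP mu) (w b : ℕ) → a = b := by
    intro a b h1 h2
    rcases lt_trichotomy a b with h | h | h
    · exact absurd h2 (hcon a b h h1)
    · exact h
    · exact absurd h2.symm (hcon b a h h1.symm)
  have hmaps : ∀ k ∈ P, rowOf (conjP mu) (w k : ℕ) ∈ Finset.range (mu 0) := by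
    intro k _
    rw [Finset.mem_range]
    by_contra hge
    have h1 := rowOf_spec hc (w k).2
    rw [cumSum_succ, conjP_eq_zero hmu (not_lt.1 hge)] at h1
    omega
  rw [Finset.card_eq_sum_card_fiberwise hmaps, ← sum_min_conjP hmu s] at hP
  refine absurd hP (not_lt.2 (Finset.sum_le_sum fun j _ => le_min ?_ ?_))
  · rw [← Finset.card_image_of_injOn (f := β)]
    · exact (Finset.card_le_card (Finset.image_subset_image (Finset.filter_subset _ _))).trans hs
    · intro a ha b hb hab
      simp only [Finset.coe_filter, Set.mem_ofPred_eq] at ha hb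
      exact hinj a b hab (ha.2.trans hb.2.symm)
  · rw [← card_rowOf hc j]
    refine Finset.card_le_card_of_injOn w ?_ w.injective.injOn
    intro a ha
    simp only [Finset.coe_filter, Set.mem_ofPred_eq, Finset.mem_univ, true_and] at ha ⊢
    exact ha.2

theorem sum_mul_mul_yElt_eq_zero (hT : IsHeckeBasis q T) (hq : q ≠ 0) {mu : ℕ → ℕ}
    (hmu : IsPartition n mu) (β : Fin n → ℕ) (hβ : Monotone β) (P : Finset (Fin n)) (s : ℕ)
    (hs : (P.image β).card ≤ s) (hP : cumSum mu s < P.card) (S : Equiv.Perm (Fin n) → Prop)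
    (hS : ∀ (k : ℕ) (hk : k + 1 < n), β ⟨k, Nat.lt_of_succ_lt hk⟩ = β ⟨k + 1, hk⟩ →
      ∀ w, S w → S (adjT k hk * w)) (x : H) :
    (∑ w ∈ Finset.univ.filter S, T w) * (x * yElt q T (conjP mu)) = 0 := by
  have hc := isComposition_conjP hmu
  have key : ∀ (l : ℕ) (w : Equiv.Perm (Fin n)), permLength w = l →
      (∑ w ∈ Finset.univ.filter S, T w) * (T w * yElt q T (conjP mu)) = 0 := by
    intro l
    induction l using Nat.strong_induction_on with
    | _ l ih =>
    intro w hwl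
    by_cases h1 : ∃ (k : ℕ) (hk : k + 1 < n),
        β ⟨k, Nat.lt_of_succ_lt hk⟩ = β ⟨k + 1, hk⟩ ∧ w ⟨k + 1, hk⟩ < w ⟨k, Nat.lt_of_succ_lt hk⟩
    · obtain ⟨k, hk, hb, hw⟩ := h1
      have hl := permLength_mul_adjT_of_gt hk w hw
      have hT1 : T w = T (adjT k hk) * T (w * adjT k hk) := by
        rw [T_adj_mul hT _ hk, mul_adjT_cancel]
        simpa [adjT] using hw
      rw [hT1, mul_assoc, ← mul_assoc, sum_mul_adj hT S hk (hS k hk hb), smul_mul_assoc,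
        ih _ (by omega) _ rfl, smul_zero]
    by_cases h2 : ∃ (k : ℕ) (hk : k + 1 < n),
        rowOf (conjP mu) k = rowOf (conjP mu) (k + 1) ∧
          w⁻¹ ⟨k + 1, hk⟩ < w⁻¹ ⟨k, Nat.lt_of_succ_lt hk⟩
    · obtain ⟨k, hk, hb, hw⟩ := h2
      have hl := permLength_adjT_mul_of_gt hk w hw
      have hT1 : T w = T (adjT k hk * w) * T (adjT k hk) := by
        rw [T_mul_asc hT _ hk, adjT_mul_cancel]
        simpa [adjT, mul_inv_rev] using hw
      have hy : T (adjT k hk) * yElt q T (conjP mu) = - yElt q T (conjP mu) := by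
        have := one_add_mul_yElt hT hq (conjP mu) hk hb
        rw [add_mul, one_mul] at this
        rw [eq_neg_iff_add_eq_zero, add_comm, this]
      rw [hT1, mul_assoc, hy, mul_neg, mul_neg, ih _ (by omega) _ rfl, neg_zero]
    push Not at h1 h2
    obtain ⟨a, b, hab, hβab, hcol⟩ := exists_lt_same_block hmu β P s hs hP w
    have hk : (a : ℕ) + 1 < n := by have := b.2; rw [Fin.lt_def] at hab; omega
    -- `w` is increasing on blocks
    have hβmid : ∀ c : Fin n, a ≤ c → c ≤ b → β c = β a := fun c hac hcb =>
      le_antisymm ((hβ hcb).trans hβab.ge) (hβ hac)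
    have hinc : ∀ d : ℕ, ∀ hd : (a : ℕ) + d < n, (a : ℕ) + d ≤ b → w a ≤ w ⟨(a : ℕ) + d, hd⟩ ∧
        ((0 < d) → w ⟨(a : ℕ) + 1, hk⟩ ≤ w ⟨(a : ℕ) + d, hd⟩) := by
      intro d
      induction d with
      | zero => exact fun hd _ => ⟨le_of_eq rfl, fun h => absurd h (lt_irrefl _)⟩
      | succ d ihd =>
        intro hd hdb
        have h3 := ihd (by omega) (by omega)
        have h4 := h1 ((a : ℕ) + d) hd (by
          rw [hβmid ⟨(a : ℕ) + d, _⟩ (by rw [Fin.le_def]; simp) (by rw [Fin.le_def]; simp; omega),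
            hβmid ⟨(a : ℕ) + d + 1, _⟩ (by rw [Fin.le_def]; simp; omega)
              (by rw [Fin.le_def]; simp; omega)])
        refine ⟨h3.1.trans h4, fun _ => ?_⟩
        rcases Nat.eq_zero_or_pos d with rfl | h0
        · exact le_of_eq rfl
        · exact (h3.2 h0).trans h4
    have hab' : (a : ℕ) < b := hab
    have hb1 : w ⟨(a : ℕ) + 1, hk⟩ ≤ w b := by
      have h3 := (hinc (b - a) (by have := b.2; omega) (by omega)).2 (by omega)
      have h4 : (⟨(a : ℕ) + (b - a), by have := b.2; omega⟩ : Fin n) = b := Fin.ext (by simp; omega)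
      rwa [h4] at h3
    have ha1 : w a < w ⟨(a : ℕ) + 1, hk⟩ := by
      refine lt_of_le_of_ne ((hinc 1 hk (by omega)).1) ?_
      intro h3
      have := w.injective h3
      rw [Fin.ext_iff] at this
      simp at this
    have hj : (w a : ℕ) + 1 < n := by have := (w ⟨(a : ℕ) + 1, hk⟩).2; rw [Fin.lt_def] at ha1; omega
    -- `w⁻¹` is increasing on columns
    have hcolmid : ∀ c : ℕ, (w a : ℕ) ≤ c → c ≤ w ⟨(a : ℕ) + 1, hk⟩ →
        rowOf (conjP mu) c = rowOf (conjP mu) (w a : ℕ) := by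
      intro c hc1 hc2
      have hcn : c ≤ w b := hc2.trans hb1
      exact le_antisymm ((rowOf_mono hc hcn (w b).2).trans hcol.ge)
        (rowOf_mono hc hc1 (lt_of_le_of_lt hcn (w b).2))
    have hinc2 : ∀ d : ℕ, ∀ hd : (w a : ℕ) + d < n, (w a : ℕ) + d ≤ w ⟨(a : ℕ) + 1, hk⟩ →
        a ≤ w⁻¹ ⟨(w a : ℕ) + d, hd⟩ ∧
        ((0 < d) → w⁻¹ ⟨(w a : ℕ) + 1, hj⟩ ≤ w⁻¹ ⟨(w a : ℕ) + d, hd⟩) := by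
      intro d
      induction d with
      | zero => exact fun hd _ => ⟨le_of_eq (perm_inv_apply w a).symm, fun h => absurd h (lt_irrefl _)⟩
      | succ d ihd =>
        intro hd hdb
        have h3 := ihd (by omega) (by omega)
        have h4 := h2 ((w a : ℕ) + d) hd (by
          rw [hcolmid ((w a : ℕ) + d) (by omega) (by omega),
            hcolmid ((w a : ℕ) + d + 1) (by omega) (by omega)])
        refine ⟨h3.1.trans h4, fun _ => ?_⟩
        rcases Nat.eq_zero_or_pos d with rfl | h0
        · exact le_of_eq rfl
        · exact (h3.2 h0).trans h4
    rw [Fin.lt_def] at ha1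
    have h5 : w⁻¹ ⟨(w a : ℕ) + 1, hj⟩ ≤ ⟨(a : ℕ) + 1, hk⟩ := by
      have h3 := (hinc2 (w ⟨(a : ℕ) + 1, hk⟩ - w a) (by omega) (by omega)).2 (by omega)
      have h4 : (⟨(w a : ℕ) + (w ⟨(a : ℕ) + 1, hk⟩ - w a), by omega⟩ : Fin n) =
          w ⟨(a : ℕ) + 1, hk⟩ := Fin.ext (by simp; omega)
      rwa [h4, perm_inv_apply] at h3
    have h6 : a < w⁻¹ ⟨(w a : ℕ) + 1, hj⟩ := by
      refine lt_of_le_of_ne ((hinc2 1 hj (by omega)).1) ?_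
      intro h3
      have h7 := congrArg w h3
      rw [perm_apply_inv, Fin.ext_iff] at h7
      simp at h7
    have h7 : w⁻¹ ⟨(w a : ℕ) + 1, hj⟩ = ⟨(a : ℕ) + 1, hk⟩ := by
      rw [Fin.le_def] at h5
      rw [Fin.lt_def] at h6
      apply Fin.ext
      simp only at h5 ⊢
      omega
    have h8 : w ⟨(a : ℕ) + 1, hk⟩ = ⟨(w a : ℕ) + 1, hj⟩ := by
      rw [← h7, perm_apply_inv]
    obtain ⟨Q, hQ⟩ := exists_eq_mul_one_add hT S hk (hS a hk (by
      rw [hβmid ⟨(a : ℕ) + 1, hk⟩ (by rw [Fin.le_def]; simp)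
        (by rw [Fin.le_def]; simp; omega)]))
    have hcomm : (1 + T (adjT (a : ℕ) hk)) * T w = T w * (1 + T (adjT (w a : ℕ) hj)) := by
      rw [add_mul, mul_add, one_mul, mul_one, T_adj_comm hT w hk hj rfl h8]
    rw [hQ, mul_assoc, ← mul_assoc (1 + _), hcomm, mul_assoc,
      one_add_mul_yElt hT hq _ hj (by rw [hcolmid ((w a : ℕ) + 1) (by omega) (by omega)]), mul_zero, mul_zero]
  have hx : x ∈ Submodule.span F (Set.range T) := by rw [hT.total]; trivial
  induction hx using Submodule.span_induction with
  | mem x hx => obtain ⟨w, rfl⟩ := hx; exact key _ w rfl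
  | zero => rw [zero_mul, mul_zero]
  | add x y _ _ h1 h2 => rw [add_mul, mul_add, h1, h2, add_zero]
  | smul c x _ h1 => rw [smul_mul_assoc, mul_smul_comm, h1, smul_zero]

end Vanishing

section Words

variable {m : ℕ}

/-- The word of `w`: the letter at position `k` is the row of `t^λ w` containing `k`. -/
def word (lam : ℕ → ℕ) (w : Equiv.Perm (Fin m)) : Fin m → ℕ := fun k => rowOf lam (w⁻¹ k : Fin m)

/-- The row of `μ` containing a position. -/
def rowFn (mu : ℕ → ℕ) : Fin m → ℕ := fun k => rowOf mu k

/-- The multisets of letters of `f` in the fibres of the block function `β`. -/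
def content (β f : Fin m → ℕ) : ℕ → Multiset ℕ :=
  fun t => (Finset.univ.filter (fun k => β k = t)).val.map f

/-- The entries of a row-standard `μ`-tableau, read along successive rows. -/
def reading (mu : ℕ → ℕ) (C : ℕ → Multiset ℕ) : Fin m → ℕ :=
  fun k => entryAt C (rowOf mu k) (k - cumSum mu (rowOf mu k))

theorem mem_content {β f : Fin m → ℕ} {t x : ℕ} :
    x ∈ content β f t ↔ ∃ k, β k = t ∧ f k = x := by
  simp [content]

theorem word_mul (lam : ℕ → ℕ) (v w : Equiv.Perm (Fin m)) :
    word lam (v * w) = word lam w ∘ ⇑v⁻¹ := by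
  funext k
  simp [word, mul_inv_rev]

theorem exists_perm_of_map_eq {α : Type*} [LinearOrder α] (f g : Fin m → α)
    (h : Finset.univ.val.map f = Finset.univ.val.map g) :
    ∃ u : Equiv.Perm (Fin m), f = g ∘ u := by
  have hperm : (List.ofFn (f ∘ Tuple.sort f)).Perm (List.ofFn (g ∘ Tuple.sort g)) := by
    refine ((Tuple.sort f).ofFn_comp_perm f).trans
      (List.Perm.trans ?_ ((Tuple.sort g).ofFn_comp_perm g).symm)
    rw [← Multiset.coe_eq_coe, ← Fin.univ_val_map, ← Fin.univ_val_map, h]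
  have heq : f ∘ Tuple.sort f = g ∘ Tuple.sort g :=
    List.ofFn_injective (hperm.eq_of_pairwise'
      (Tuple.monotone_sort f).sortedLE_ofFn.pairwise
      (Tuple.monotone_sort g).sortedLE_ofFn.pairwise)
  refine ⟨Tuple.sort g * (Tuple.sort f)⁻¹, ?_⟩
  funext k
  have := congrFun heq ((Tuple.sort f)⁻¹ k)
  simpa using this

theorem content_eq_iff (β f g : Fin m → ℕ) :
    content β f = content β g ↔
      ∃ u : Equiv.Perm (Fin m), (∀ k, β (u k) = β k) ∧ f = g ∘ u := by
  constructor
  · intro h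
    obtain ⟨u, hu⟩ := exists_perm_of_map_eq (fun k => toLex (β k, f k))
      (fun k => toLex (β k, g k)) (by
        ext ⟨t, x⟩
        have h1 := congrArg (Multiset.count x) (congrFun h t)
        have key : ∀ f : Fin m → ℕ, Multiset.count (toLex (t, x))
            (Finset.univ.val.map (fun k => toLex (β k, f k))) =
              Multiset.count x (content β f t) := by
          intro f
          rw [content, Multiset.count_map, Multiset.count_map, Finset.filter_val,
            Multiset.filter_filter]
          refine congrArg _ (Multiset.filter_congr fun k _ => ?_)
          rw [toLex_inj, Prod.mk_inj]
          exact ⟨fun h => ⟨h.2, h.1.symm⟩, fun h => ⟨h.2.symm, h.1⟩⟩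
        exact (key f).trans (h1.trans (key g).symm))
    refine ⟨u, fun k => ?_, ?_⟩
    · have h2 := congrFun hu k
      simp only [Function.comp_apply, toLex_inj, Prod.mk.injEq] at h2
      exact h2.1.symm
    · funext k
      have h2 := congrFun hu k
      simp only [Function.comp_apply, toLex_inj, Prod.mk.injEq] at h2
      exact h2.2
  · rintro ⟨u, hu, rfl⟩
    funext t
    unfold content
    rw [← Multiset.map_map]
    congr 1
    have himg : (Finset.univ.filter (fun k => β k = t)).image u =
        Finset.univ.filter (fun k => β k = t) := by
      ext k
      simp only [Finset.mem_image, Finset.mem_filter, Finset.mem_univ, true_and]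
      constructor
      · rintro ⟨a, ha, rfl⟩
        rw [hu, ha]
      · intro hk
        refine ⟨u⁻¹ k, ?_, perm_apply_inv u k⟩
        rw [← hu, perm_apply_inv, hk]
    rw [← Finset.image_val_of_injOn u.injective.injOn, himg]

theorem content_comp (β f : Fin m → ℕ) (u : Equiv.Perm (Fin m)) (hu : ∀ k, β (u k) = β k) :
    content β (f ∘ u) = content β f :=
  (content_eq_iff _ _ _).2 ⟨u, hu, rfl⟩

theorem block_inv {β : Fin m → ℕ} {u : Equiv.Perm (Fin m)} (hu : ∀ k, β (u k) = β k)
    (k : Fin m) : β (u⁻¹ k) = β k := by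
  rw [← hu, perm_apply_inv]

theorem block_adjT {β : Fin m → ℕ} {k : ℕ} (hk : k + 1 < m)
    (h : β ⟨k, Nat.lt_of_succ_lt hk⟩ = β ⟨k + 1, hk⟩) (a : Fin m) :
    β (adjT k hk a) = β a := by
  unfold adjT
  rw [Equiv.swap_apply_def]
  split_ifs with h1 h2
  · rw [h1, h]
  · rw [h2, h]
  · rfl

theorem content_word_mul (lam : ℕ → ℕ) (β : Fin m → ℕ) (v w : Equiv.Perm (Fin m))
    (hv : ∀ k, β (v k) = β k) : content β (word lam (v * w)) = content β (word lam w) := by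
  rw [word_mul, content_comp _ _ _ (block_inv hv)]

theorem mem_doubleCoset_iff (lam mu : ℕ → ℕ) (d w : Equiv.Perm (Fin m)) :
    w ∈ doubleCoset lam mu d ↔
      content (rowFn mu) (word lam w) = content (rowFn mu) (word lam d) := by
  constructor
  · rintro ⟨u, hu, v, hv, rfl⟩
    rw [mul_assoc, content_word_mul lam (rowFn mu) v _ (fun k => hv k), word_mul]
    congr 1
    funext k
    have := hu (u⁻¹ (d⁻¹ k))
    rw [perm_apply_inv] at this
    simpa [word, mul_inv_rev] using this.symm
  · intro h
    obtain ⟨v, hv, hvw⟩ := (content_eq_iff _ _ _).1 h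
    refine ⟨(v⁻¹ * d)⁻¹ * w, ?_, v⁻¹, block_inv hv, by group⟩
    intro p
    have := congrFun hvw (w p)
    simp only [word, Function.comp_apply, perm_inv_apply] at this
    rw [this]
    simp [mul_inv_rev]

theorem card_content {mu : ℕ → ℕ} (hmu : IsComposition m mu) (f : Fin m → ℕ) :
    RowsOfShape mu (content (rowFn mu) f) := by
  intro r
  rw [← card_rowOf hmu r, content, Multiset.card_map]
  rfl

theorem entryAt_map_range (C : ℕ → Multiset ℕ) (r : ℕ) :
    (Multiset.range (C r).card).map (entryAt C r) = C r := by
  conv_rhs => rw [← Multiset.sort_eq (C r) (· ≤ ·)]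
  rw [Multiset.range, Multiset.map_coe, ← Multiset.length_sort (s := C r) (r := (· ≤ ·))]
  congr 1
  apply List.ext_getElem
  · simp
  · intro i h1 h2
    simp [entryAt, List.getElem?_eq_getElem h2]

theorem content_reading {mu : ℕ → ℕ} (hmu : IsComposition m mu) (C : ℕ → Multiset ℕ)
    (hC : RowsOfShape mu C) : content (rowFn mu) (reading (m := m) mu C) = C := by
  funext r
  unfold content
  conv_rhs => rw [← entryAt_map_range C r]
  have himg : (Finset.univ.filter (fun k : Fin m => rowFn mu k = r)).image
      (fun k : Fin m => (k : ℕ) - cumSum mu r) = Finset.range (C r).card := by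
    ext x
    simp only [Finset.mem_image, Finset.mem_filter, Finset.mem_univ, true_and, Finset.mem_range]
    simp only [rowFn]
    rw [hC r]
    constructor
    · rintro ⟨k, hk, rfl⟩
      have := (rowOf_eq_iff hmu k.2).1 hk
      rw [cumSum_succ] at this
      omega
    · intro hx
      have h1 := hmu.cumSum_le (r + 1)
      rw [cumSum_succ] at h1
      have hlt : cumSum mu r + x < m := by omega
      refine ⟨⟨cumSum mu r + x, hlt⟩, (rowOf_eq_iff hmu hlt).2 ?_, by simp⟩
      rw [cumSum_succ]
      omega
  have hval := congrArg Finset.val himg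
  rw [Finset.image_val_of_injOn, Finset.range_val] at hval
  · rw [← hval, Multiset.map_map]
    apply Multiset.map_congr rfl
    intro k hk
    have hk' : rowFn mu k = r := (Finset.mem_filter.1 (Finset.mem_def.2 hk)).2
    have hk' : rowOf mu k = r := hk'
    simp [reading, hk']
  · intro a ha b hb hab
    simp only [Finset.coe_filter, Set.mem_ofPred_eq, Finset.mem_univ, true_and] at ha hb
    simp only [rowFn] at ha hb
    have h1 := (rowOf_eq_iff hmu a.2).1 ha
    have h2 := (rowOf_eq_iff hmu b.2).1 hb
    simp only at hab
    apply Fin.ext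
    omega

theorem hasType_content_word {lam : ℕ → ℕ} (hlam : IsComposition m lam) (mu : ℕ → ℕ)
    (w : Equiv.Perm (Fin m)) : HasType (content (rowFn mu) (word lam w)) lam := by
  intro v
  rw [finsum_eq_sum_of_support_subset (s := Finset.univ.image (rowFn (m := m) mu))]
  · rw [← card_rowOf hlam v]
    have h1 : ∀ r, Multiset.count v (content (rowFn mu) (word lam w) r) =
        ((Finset.univ.filter (fun k => word lam w k = v)).filter
          (fun k => rowFn mu k = r)).card := by
      intro r
      rw [content, Multiset.count_map, ← Finset.filter_val, Finset.filter_filter,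
        Finset.filter_filter]
      simp only [eq_comm, and_comm]
      rfl
    simp only [h1]
    rw [← Finset.card_eq_sum_card_fiberwise (fun k _ => by simp)]
    refine Finset.card_bij (fun k _ => w⁻¹ k) ?_ ?_ ?_
    · intro k hk
      rw [Finset.mem_filter] at hk ⊢
      exact ⟨Finset.mem_univ _, hk.2⟩
    · intro a _ b _ h
      exact w⁻¹.injective h
    · intro b hb
      refine ⟨w b, ?_, perm_inv_apply w b⟩
      rw [Finset.mem_filter] at hb ⊢
      refine ⟨Finset.mem_univ _, ?_⟩
      rw [word, perm_inv_apply]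
      exact hb.2
  · intro r hr
    simp only [Function.mem_support, ne_eq, Multiset.count_eq_zero, not_not] at hr
    obtain ⟨k, hk, -⟩ := mem_content.1 hr
    simp only [Finset.coe_image, Finset.coe_univ, Set.image_univ, Set.mem_range]
    exact ⟨k, hk⟩

theorem word_eq_reading_of_is1A {mu lam : ℕ → ℕ} {C : ℕ → Multiset ℕ} {d : Equiv.Perm (Fin m)}
    (h : Is1A mu lam C d) : word lam d = reading mu C := by
  funext k
  have := h.2 (d⁻¹ k)
  rw [perm_apply_inv] at this
  exact this.symm

theorem exists_is1A {mu lam : ℕ → ℕ} (hmu : IsComposition m mu) (hlam : IsComposition m lam)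
    (w : Equiv.Perm (Fin m)) :
    ∃ d : Equiv.Perm (Fin m), Is1A mu lam (content (rowFn mu) (word lam w)) d := by
  set C := content (rowFn mu) (word lam w) with hC
  obtain ⟨u, -, hu⟩ := (content_eq_iff (rowFn mu) (reading mu C) (word lam w)).1
    (content_reading hmu C (card_content hmu _))
  have h1 : reading mu C ∘ ⇑(u⁻¹ * w) = fun p : Fin m => rowOf lam p := by
    funext p
    simp [hu, word]
  have h2 : Monotone (reading mu C ∘ ⇑(u⁻¹ * w)) := by
    rw [h1]
    exact fun a b hab => rowOf_mono hlam hab b.2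
  have h3 := Tuple.unique_monotone (Tuple.monotone_sort (reading mu C)) h2
  rw [h1] at h3
  have h4 := (Tuple.eq_sort_iff (f := reading (m := m) mu C)).1 rfl
  refine ⟨Tuple.sort (reading mu C), fun p p' hrow hlt => h4.2 p p' hlt ?_, fun p => ?_⟩
  · exact (congrFun h3 p).trans (hrow.trans (congrFun h3 p').symm)
  · exact congrFun h3 p

theorem sorted_getD_iff (p : ℕ → Prop) (hp : ∀ x y, x ≤ y → p y → p x) (l : List ℕ)
    (hl : l.Pairwise (· ≤ ·)) :
    ∀ i, i < l.length → (p (l.getD i 0) ↔ i < l.countP (fun x => decide (p x))) := by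
  induction l with
  | nil => intro i hi; simp at hi
  | cons x l ih =>
    intro i hi
    rw [List.pairwise_cons] at hl
    by_cases hx : p x
    · rw [List.countP_cons_of_pos (by simpa using hx)]
      cases i with
      | zero => simpa using hx
      | succ i =>
        rw [List.getD_cons_succ, ih hl.2 i (by simpa using hi)]
        omega
    · have h0 : (x :: l).countP (fun x => decide (p x)) = 0 := by
        rw [List.countP_eq_zero]
        intro y hy
        rcases List.mem_cons.1 hy with rfl | hy
        · simpa using hx
        · simpa using fun h => hx (hp x y (hl.1 y hy) h)
      rw [h0]
      simp only [not_lt_zero, iff_false]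
      intro hcon
      cases i with
      | zero => exact hx (by simpa using hcon)
      | succ i =>
        have hi' : i < l.length := by simpa using hi
        rw [List.getD_cons_succ, List.getD_eq_getElem _ _ hi'] at hcon
        exact hx (hp _ _ (hl.1 _ (List.getElem_mem hi')) hcon)

theorem entryAt_iff (p : ℕ → Prop) (hp : ∀ x y, x ≤ y → p y → p x) (C : ℕ → Multiset ℕ)
    (r i : ℕ) (hi : i < (C r).card) :
    p (entryAt C r i) ↔ i < ((C r).sort (· ≤ ·)).countP (fun x => decide (p x)) :=
  sorted_getD_iff p hp _ (Multiset.pairwise_sort _ _) i (by simpa using hi)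

end Words

section Coefficients

variable {F : Type*} [Field F] {H : Type*} [Ring H] [Algebra F H] {n : ℕ}
  {q : F} {T : Equiv.Perm (Fin n) → H}

/-- The basis of the Hecke algebra underlying `IsHeckeBasis`. -/
def IsHeckeBasis.basis (hT : IsHeckeBasis q T) : Module.Basis (Equiv.Perm (Fin n)) F H :=
  Module.Basis.mk hT.li hT.total.ge

/-- The coefficient of `T w` in an element of the Hecke algebra. -/
def IsHeckeBasis.coef (hT : IsHeckeBasis q T) (w : Equiv.Perm (Fin n)) : H →ₗ[F] F :=
  hT.basis.coord w

theorem coef_T (hT : IsHeckeBasis q T) (w x : Equiv.Perm (Fin n)) :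
    hT.coef w (T x) = if x = w then 1 else 0 := by
  have h : T x = hT.basis x := by simp [IsHeckeBasis.basis]
  rw [IsHeckeBasis.coef, h, Module.Basis.coord_apply, Module.Basis.repr_self,
    Finsupp.single_apply]

theorem sum_coef (hT : IsHeckeBasis q T) (h : H) : ∑ w, hT.coef w h • T w = h := by
  conv_rhs => rw [← hT.basis.sum_repr h]
  simp [IsHeckeBasis.coef, IsHeckeBasis.basis]

theorem coef_mul_adj_asc (hT : IsHeckeBasis q T) (w : Equiv.Perm (Fin n)) {j : ℕ}
    (hj : j + 1 < n) (hw : w⁻¹ ⟨j, Nat.lt_of_succ_lt hj⟩ < w⁻¹ ⟨j + 1, hj⟩) (h : H) :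
    hT.coef w (h * T (adjT j hj)) = q * hT.coef (adjT j hj * w) h := by
  have key : (hT.coef w).comp (LinearMap.mulRight F (T (adjT j hj))) =
      q • hT.coef (adjT j hj * w) := by
    refine hT.basis.ext fun x => ?_
    have hx : hT.basis x = T x := by simp [IsHeckeBasis.basis]
    rw [hx, LinearMap.comp_apply, LinearMap.mulRight_apply, LinearMap.smul_apply, coef_T]
    rcases inv_lt_or_gt x hj with h1 | h1
    · have h2 : x ≠ adjT j hj * w := by
        rintro rfl
        rw [mul_inv_rev, adjT_inv] at h1
        simp only [adjT, Equiv.Perm.mul_apply, Equiv.swap_apply_left,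
          Equiv.swap_apply_right] at h1
        exact lt_asymm h1 hw
      rw [T_mul_asc hT x hj h1, coef_T, if_neg h2, if_neg, smul_zero]
      rintro rfl
      exact h2 (adjT_mul_cancel hj x).symm
    · have h2 : x ≠ w := by
        rintro rfl
        exact lt_asymm h1 hw
      rw [T_mul_desc hT x hj h1, map_add, map_smul, map_smul, coef_T, coef_T, if_neg h2]
      have h3 : adjT j hj * x = w ↔ x = adjT j hj * w :=
        ⟨fun h => by rw [← h, adjT_mul_cancel], fun h => by rw [h, adjT_mul_cancel]⟩
      simp only [h3, smul_zero, add_zero]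
  exact LinearMap.congr_fun key h

theorem coef_mul_adj_desc (hT : IsHeckeBasis q T) (w : Equiv.Perm (Fin n)) {j : ℕ}
    (hj : j + 1 < n) (hw : w⁻¹ ⟨j + 1, hj⟩ < w⁻¹ ⟨j, Nat.lt_of_succ_lt hj⟩) (h : H) :
    hT.coef w (h * T (adjT j hj)) =
      hT.coef (adjT j hj * w) h + (q - 1) * hT.coef w h := by
  have key : (hT.coef w).comp (LinearMap.mulRight F (T (adjT j hj))) =
      hT.coef (adjT j hj * w) + (q - 1) • hT.coef w := by
    refine hT.basis.ext fun x => ?_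
    have hx : hT.basis x = T x := by simp [IsHeckeBasis.basis]
    rw [hx, LinearMap.comp_apply, LinearMap.mulRight_apply, LinearMap.add_apply,
      LinearMap.smul_apply, coef_T, coef_T]
    have h3 : adjT j hj * x = w ↔ x = adjT j hj * w :=
      ⟨fun h => by rw [← h, adjT_mul_cancel], fun h => by rw [h, adjT_mul_cancel]⟩
    rcases inv_lt_or_gt x hj with h1 | h1
    · have h2 : x ≠ w := by
        rintro rfl
        exact lt_asymm h1 hw
      rw [T_mul_asc hT x hj h1, coef_T, if_neg h2]
      simp only [h3, smul_zero, add_zero]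
    · have h2 : x ≠ adjT j hj * w := by
        rintro rfl
        rw [mul_inv_rev, adjT_inv] at h1
        simp only [adjT, Equiv.Perm.mul_apply, Equiv.swap_apply_left,
          Equiv.swap_apply_right] at h1
        exact lt_asymm h1 hw
      rw [T_mul_desc hT x hj h1, map_add, map_smul, map_smul, coef_T, coef_T, if_neg h2,
        if_neg (fun h => h2 (h3.1 h)), smul_zero]
  exact LinearMap.congr_fun key h

theorem row_eq_of_descent {mu : ℕ → ℕ} (hmu : IsComposition n mu) {e : Equiv.Perm (Fin n)}
    (he : e ∈ youngW mu) {i : ℕ} (hi : i + 1 < n)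
    (hlt : e⁻¹ ⟨i + 1, hi⟩ < e⁻¹ ⟨i, Nat.lt_of_succ_lt hi⟩) :
    rowOf mu i = rowOf mu (i + 1) := by
  refine le_antisymm (rowOf_mono hmu (Nat.le_succ i) hi) ?_
  have h2 := block_inv (β := rowFn mu) (u := e) (fun k => he k) ⟨i, Nat.lt_of_succ_lt hi⟩
  have h3 := block_inv (β := rowFn mu) (u := e) (fun k => he k) ⟨i + 1, hi⟩
  have h4 := rowOf_mono hmu (le_of_lt (Fin.lt_def.1 hlt)) (Fin.is_lt _)
  rw [← rowFn, ← rowFn, h2, h3] at h4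
  exact h4

theorem adjT_mul_mem_youngW {mu : ℕ → ℕ} {e : Equiv.Perm (Fin n)} (he : e ∈ youngW mu) {i : ℕ}
    (hi : i + 1 < n) (hrow : rowOf mu i = rowOf mu (i + 1)) : adjT i hi * e ∈ youngW mu :=
  fun k => (block_adjT (β := rowFn mu) hi hrow (e k)).trans (he k)

theorem mul_T_mem (hT : IsHeckeBasis q T) {mu : ℕ → ℕ} (hmu : IsComposition n mu)
    (V : Submodule F H)
    (hV : ∀ j (hj : j + 1 < n), rowOf mu j = rowOf mu (j + 1) → ∀ h ∈ V, h * T (adjT j hj) ∈ V) :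
    ∀ (l : ℕ) (e : Equiv.Perm (Fin n)), permLength e = l → e ∈ youngW mu →
      ∀ h ∈ V, h * T e ∈ V := by
  intro l
  induction l with
  | zero =>
    intro e hl he h hh
    by_cases h1 : e = 1
    · rwa [h1, hT.one, mul_one]
    · obtain ⟨i, hi, hlt⟩ := exists_inv_gt_of_ne_one e h1
      have := permLength_adjT_mul_of_gt hi e hlt
      omega
  | succ l ih =>
    intro e hl he h hh
    have h1 : e ≠ 1 := by
      rintro rfl
      rw [permLength_one] at hl
      omega
    obtain ⟨i, hi, hlt⟩ := exists_inv_gt_of_ne_one e h1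
    have hlen := permLength_adjT_mul_of_gt hi e hlt
    have hrow := row_eq_of_descent hmu he hi hlt
    have he' := adjT_mul_mem_youngW he hi hrow
    have hTe : T e = T (adjT i hi * e) * T (adjT i hi) := by
      rw [hT.mul_adj_asc, adjT_mul_cancel]
      rw [adjT_mul_cancel]
      omega
    rw [hTe, ← mul_assoc]
    exact hV i hi hrow _ (ih _ (by omega) he' h hh)

theorem coef_mul_T_eq_zero (hT : IsHeckeBasis q T) {mu : ℕ → ℕ} (hmu : IsComposition n mu)
    (Q : Equiv.Perm (Fin n) → Prop)
    (hQ : ∀ j (hj : j + 1 < n), rowOf mu j = rowOf mu (j + 1) → ∀ w, Q w → Q (adjT j hj * w))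
    {e : Equiv.Perm (Fin n)} (he : e ∈ youngW mu) {h : H} (hh : ∀ w, Q w → hT.coef w h = 0)
    (w : Equiv.Perm (Fin n)) (hw : Q w) : hT.coef w (h * T e) = 0 := by
  let V : Submodule F H := ⨅ w ∈ {w | Q w}, LinearMap.ker (hT.coef w)
  have hV : ∀ h, h ∈ V ↔ ∀ w, Q w → hT.coef w h = 0 := by
    intro h
    simp [V, Submodule.mem_iInf]
  refine (hV _).1 (mul_T_mem hT hmu V ?_ _ e rfl he h ((hV h).2 hh)) w hw
  intro j hj hrow h hh
  rw [hV] at hh ⊢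
  intro w hw
  rcases inv_lt_or_gt w hj with h1 | h1
  · rw [coef_mul_adj_asc hT w hj h1, hh _ (hQ j hj hrow w hw), mul_zero]
  · rw [coef_mul_adj_desc hT w hj h1, hh _ (hQ j hj hrow w hw), hh w hw, mul_zero, add_zero]

theorem word_adjT (lam : ℕ → ℕ) {j : ℕ} (hj : j + 1 < n) (w : Equiv.Perm (Fin n)) :
    word lam (adjT j hj * w) = word lam w ∘ adjT j hj := by
  rw [word_mul, adjT_inv]

theorem inv_lt_of_word_lt {lam : ℕ → ℕ} (hlam : IsComposition n lam) {w : Equiv.Perm (Fin n)}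
    {a b : Fin n} (h : word lam w a < word lam w b) : w⁻¹ a < w⁻¹ b := by
  by_contra hcon
  have := rowOf_mono hlam (Fin.le_def.1 (not_lt.1 hcon)) (w⁻¹ a).2
  simp only [word] at h
  omega

theorem coef_mul_T_eq_of_word_eq (hT : IsHeckeBasis q T) {mu lam : ℕ → ℕ}
    (hmu : IsComposition n mu) (hlam : IsComposition n lam)
    {e : Equiv.Perm (Fin n)} (he : e ∈ youngW mu) {h : H}
    (hh : ∀ w w', word lam w = word lam w' → hT.coef w h = hT.coef w' h)
    (w w' : Equiv.Perm (Fin n)) (hw : word lam w = word lam w') :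
    hT.coef w (h * T e) = hT.coef w' (h * T e) := by
  let V : Submodule F H := ⨅ p ∈ {p : Equiv.Perm (Fin n) × Equiv.Perm (Fin n) |
    word lam p.1 = word lam p.2}, LinearMap.ker (hT.coef p.1 - hT.coef p.2)
  have hV : ∀ h, h ∈ V ↔ ∀ w w', word lam w = word lam w' → hT.coef w h = hT.coef w' h := by
    intro h
    simp [V, Submodule.mem_iInf, sub_eq_zero]
  refine (hV _).1 (mul_T_mem hT hmu V ?_ _ e rfl he h ((hV h).2 hh)) w w' hw
  intro j hj _ h hh
  rw [hV] at hh ⊢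
  intro w w' hw
  have hs : word lam (adjT j hj * w) = word lam (adjT j hj * w') := by
    rw [word_adjT, word_adjT, hw]
  rcases lt_trichotomy (word lam w ⟨j, Nat.lt_of_succ_lt hj⟩) (word lam w ⟨j + 1, hj⟩)
    with h1 | h1 | h1
  · have h1' := hw ▸ h1
    rw [coef_mul_adj_asc hT w hj (inv_lt_of_word_lt hlam h1),
      coef_mul_adj_asc hT w' hj (inv_lt_of_word_lt hlam h1'), hh _ _ hs]
  · have key : ∀ x, word lam x = word lam w →
        hT.coef x (h * T (adjT j hj)) = q * hT.coef w h := by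
      intro x hx
      have hsx : word lam (adjT j hj * x) = word lam x := by
        rw [word_adjT]
        funext k
        rw [← hx] at h1
        exact block_adjT (β := word lam x) hj h1 k
      rcases inv_lt_or_gt x hj with h2 | h2
      · rw [coef_mul_adj_asc hT x hj h2, hh _ _ (hsx.trans hx)]
      · rw [coef_mul_adj_desc hT x hj h2, hh _ _ (hsx.trans hx), hh _ _ hx]
        ring
    rw [key w rfl, key w' hw.symm]
  · have h1' := hw ▸ h1
    rw [coef_mul_adj_desc hT w hj (inv_lt_of_word_lt hlam h1),
      coef_mul_adj_desc hT w' hj (inv_lt_of_word_lt hlam h1'), hh _ _ hs, hh _ _ hw]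

theorem coef_mul_left_eq (hT : IsHeckeBasis q T) (hq : q ≠ 0) {mu : ℕ → ℕ}
    (hmu : IsComposition n mu) {h : H}
    (hh : ∀ j (hj : j + 1 < n), rowOf mu j = rowOf mu (j + 1) → h * T (adjT j hj) = q • h) :
    ∀ (l : ℕ) (v w : Equiv.Perm (Fin n)), permLength v = l → v ∈ youngW mu →
      hT.coef (v * w) h = hT.coef w h := by
  have hs : ∀ j (hj : j + 1 < n), rowOf mu j = rowOf mu (j + 1) → ∀ w,
      hT.coef (adjT j hj * w) h = hT.coef w h := by
    intro j hj hrow w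
    have h0 : hT.coef w (h * T (adjT j hj)) = q * hT.coef w h := by
      rw [hh j hj hrow, map_smul, smul_eq_mul]
    rcases inv_lt_or_gt w hj with h1 | h1
    · rw [coef_mul_adj_asc hT w hj h1] at h0
      exact mul_left_cancel₀ hq h0
    · rw [coef_mul_adj_desc hT w hj h1] at h0
      linear_combination h0
  intro l
  induction l with
  | zero =>
    intro v w hl hv
    by_cases h1 : v = 1
    · rw [h1, one_mul]
    · obtain ⟨i, hi, hlt⟩ := exists_inv_gt_of_ne_one v h1
      have := permLength_adjT_mul_of_gt hi v hlt
      omega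
  | succ l ih =>
    intro v w hl hv
    have h1 : v ≠ 1 := by
      rintro rfl
      rw [permLength_one] at hl
      omega
    obtain ⟨i, hi, hlt⟩ := exists_inv_gt_of_ne_one v h1
    have hlen := permLength_adjT_mul_of_gt hi v hlt
    have hrow := row_eq_of_descent hmu hv hi hlt
    rw [← ih (adjT i hi * v) w (by omega) (adjT_mul_mem_youngW hv hi hrow), mul_assoc,
      hs i hi hrow]

end Coefficients
section Shuffles

variable {F : Type*} [Field F] {H : Type*} [Ring H] [Algebra F H] {n : ℕ}
  {q : F} {T : Equiv.Perm (Fin n) → H}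

/-- The minimal coset representatives in `W_μ` for the subgroup preserving both the rows of `μ`
and the fibres of `β`. -/
def IsShuffle (mu : ℕ → ℕ) (β : Fin n → ℕ) (e : Equiv.Perm (Fin n)) : Prop :=
  e ∈ youngW mu ∧ ∀ a b : Fin n, a < b → rowFn mu a = rowFn mu b → β a = β b → e a < e b

theorem isShuffle_one (mu : ℕ → ℕ) (β : Fin n → ℕ) : IsShuffle mu β 1 :=
  ⟨fun _ => rfl, fun _ _ h _ _ => h⟩

theorem adjT_lt_of_lt {j : ℕ} (hj : j + 1 < n) {a b : Fin n} (hab : a < b)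
    (h : ¬ (a = ⟨j, Nat.lt_of_succ_lt hj⟩ ∧ b = ⟨j + 1, hj⟩)) : adjT j hj a < adjT j hj b := by
  simp only [Fin.ext_iff] at h
  unfold adjT
  rw [Equiv.swap_apply_def, Equiv.swap_apply_def]
  split_ifs with h1 h2 h3 h4 h5 h6 h7 <;> simp only [Fin.ext_iff, Fin.lt_def] at * <;> omega

theorem exists_adj_of_not_isShuffle {mu : ℕ → ℕ} (hmu : IsComposition n mu) {β : Fin n → ℕ}
    (hβ : Monotone β) {e : Equiv.Perm (Fin n)} (he : IsShuffle mu β e) {j : ℕ} (hj : j + 1 < n)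
    (hrow : rowOf mu j = rowOf mu (j + 1)) (hne : ¬ IsShuffle mu β (adjT j hj * e)) :
    ∃ (p : ℕ) (hp : p + 1 < n), e ⟨p, Nat.lt_of_succ_lt hp⟩ = ⟨j, Nat.lt_of_succ_lt hj⟩ ∧
      e ⟨p + 1, hp⟩ = ⟨j + 1, hj⟩ ∧ β ⟨p, Nat.lt_of_succ_lt hp⟩ = β ⟨p + 1, hp⟩ := by
  have h1 : ∃ a b : Fin n, a < b ∧ rowFn mu a = rowFn mu b ∧ β a = β b ∧
      e a = ⟨j, Nat.lt_of_succ_lt hj⟩ ∧ e b = ⟨j + 1, hj⟩ := by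
    by_contra hcon
    refine hne ⟨adjT_mul_mem_youngW he.1 hj hrow, fun a b hab hr hb => ?_⟩
    exact adjT_lt_of_lt hj (he.2 a b hab hr hb) fun h => hcon ⟨a, b, hab, hr, hb, h⟩
  obtain ⟨a, b, hab, hr, hb, hea, heb⟩ := h1
  have hb1 : (b : ℕ) = a + 1 := by
    by_contra hne
    have hlt : (a : ℕ) + 1 < b := by
      have := Fin.lt_def.1 hab
      omega
    let c : Fin n := ⟨a + 1, lt_trans hlt b.2⟩
    have hac : a < c := Fin.lt_def.2 (Nat.lt_succ_self _)
    have hcb : c < b := Fin.lt_def.2 hlt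
    have hr1 : rowFn mu a ≤ rowFn mu c := rowOf_mono hmu (Fin.le_def.1 hac.le) c.2
    have hr2 : rowFn mu c ≤ rowFn mu b := rowOf_mono hmu (Fin.le_def.1 hcb.le) b.2
    have hb1 := hβ hac.le
    have hb2 := hβ hcb.le
    have h3 := he.2 a c hac (by omega) (by omega)
    have h4 := he.2 c b hcb (by omega) (by omega)
    rw [hea] at h3
    rw [heb] at h4
    simp only [Fin.lt_def] at h3 h4
    omega
  have hbeq : b = ⟨a + 1, hb1 ▸ b.2⟩ := Fin.ext hb1
  exact ⟨a, hb1 ▸ b.2, hea, by rw [← hbeq, heb], by rw [← hbeq]; exact hb⟩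

theorem sum_mul_shuffle_mul_adj (hT : IsHeckeBasis q T) {mu : ℕ → ℕ} (hmu : IsComposition n mu)
    {β : Fin n → ℕ} (hβ : Monotone β) (S : Equiv.Perm (Fin n) → Prop)
    (hS : ∀ k (hk : k + 1 < n), β ⟨k, Nat.lt_of_succ_lt hk⟩ = β ⟨k + 1, hk⟩ →
      ∀ w, S w → S (adjT k hk * w))
    {j : ℕ} (hj : j + 1 < n) (hrow : rowOf mu j = rowOf mu (j + 1)) :
    ((∑ w ∈ Finset.univ.filter S, T w) * ∑ e ∈ Finset.univ.filter (IsShuffle mu β), T e) *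
        T (adjT j hj) =
      q • ((∑ w ∈ Finset.univ.filter S, T w) *
        ∑ e ∈ Finset.univ.filter (IsShuffle mu β), T e) := by
  have hK : ∀ k (hk : k + 1 < n), β ⟨k, Nat.lt_of_succ_lt hk⟩ = β ⟨k + 1, hk⟩ →
      (∑ w ∈ Finset.univ.filter S, T w) * T (adjT k hk) =
        q • ∑ w ∈ Finset.univ.filter S, T w :=
    fun k hk h => sum_mul_adj hT S hk (hS k hk h)
  generalize ∑ w ∈ Finset.univ.filter S, T w = K at hK ⊢
  have hsplit : ∑ e ∈ Finset.univ.filter (IsShuffle mu β), T e =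
      ∑ e ∈ Finset.univ.filter
        (fun e => IsShuffle mu β e ∧ IsShuffle mu β (adjT j hj * e)), T e +
      ∑ e ∈ Finset.univ.filter
        (fun e => IsShuffle mu β e ∧ ¬ IsShuffle mu β (adjT j hj * e)), T e := by
    rw [← Finset.sum_filter_add_sum_filter_not (Finset.univ.filter (IsShuffle mu β))
      (fun e => IsShuffle mu β (adjT j hj * e)), Finset.filter_filter, Finset.filter_filter]
  rw [hsplit, mul_add, add_mul, smul_add]
  congr 1
  · rw [mul_assoc, ← mul_smul_comm]
    congr 1
    convert sum_mul_adj hT (fun e => IsShuffle mu β e ∧ IsShuffle mu β (adjT j hj * e)) hj ?_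
    intro w hw
    rw [adjT_mul_cancel]
    exact ⟨hw.2, hw.1⟩
  · rw [mul_assoc, Finset.sum_mul, Finset.mul_sum, Finset.mul_sum, Finset.smul_sum]
    refine Finset.sum_congr rfl fun e he => ?_
    rw [Finset.mem_filter] at he
    obtain ⟨p, hp, h1, h2, h3⟩ := exists_adj_of_not_isShuffle hmu hβ he.2.1 hj hrow he.2.2
    rw [← T_adj_comm hT e hp hj h1 h2, ← mul_assoc, hK p hp h3,
      smul_mul_assoc]

/-- Elements with coefficients constant on rows-content classes: the structure of
`(∑_{S} T_w) (∑_{shuffles} T_e)`. -/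
theorem coef_eq_of_content_eq (hT : IsHeckeBasis q T) (hq : q ≠ 0) {mu lam : ℕ → ℕ}
    (hmu : IsComposition n mu) {h : H}
    (hh : ∀ j (hj : j + 1 < n), rowOf mu j = rowOf mu (j + 1) → h * T (adjT j hj) = q • h)
    (hw : ∀ w w', word lam w = word lam w' → hT.coef w h = hT.coef w' h)
    (w w' : Equiv.Perm (Fin n))
    (hc : content (rowFn mu) (word lam w) = content (rowFn mu) (word lam w')) :
    hT.coef w h = hT.coef w' h := by
  obtain ⟨u, hu, huw⟩ := (content_eq_iff _ _ _).1 hc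
  rw [← coef_mul_left_eq hT hq hmu hh _ u⁻¹ w' rfl (fun k => block_inv hu k)]
  apply hw
  rw [huw, word_mul, inv_inv]

theorem coef_sum_filter (hT : IsHeckeBasis q T) (S : Equiv.Perm (Fin n) → Prop)
    (w : Equiv.Perm (Fin n)) :
    hT.coef w (∑ x ∈ Finset.univ.filter S, T x) = if S w then 1 else 0 := by
  rw [map_sum]
  simp only [coef_T]
  rw [Finset.sum_ite_eq']
  simp

theorem coef_sum_mul_shuffle_eq_one (hT : IsHeckeBasis q T) {mu lam : ℕ → ℕ}
    (hmu : IsComposition n mu) {β : Fin n → ℕ} (S : Equiv.Perm (Fin n) → Prop)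
    {w0 : Equiv.Perm (Fin n)} (hw0 : S w0)
    (hinv : ∀ w e, S w → content (rowFn mu) (word lam w) = content (rowFn mu) (word lam w0) →
      IsShuffle mu β e → ∀ a b, a < b → e b < e a → w⁻¹ a < w⁻¹ b)
    (huniq : ∀ w e, S w → content (rowFn mu) (word lam w) = content (rowFn mu) (word lam w0) →
      IsShuffle mu β e → e * w = w0 → e = 1) :
    hT.coef w0 ((∑ w ∈ Finset.univ.filter S, T w) *
      ∑ e ∈ Finset.univ.filter (IsShuffle mu β), T e) = 1 := by
  rw [Finset.sum_mul, map_sum, Finset.sum_eq_single w0]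
  · rw [Finset.mul_sum, map_sum, Finset.sum_eq_single 1]
    · rw [hT.one, mul_one, coef_T, if_pos rfl]
    · intro e he hne
      rw [Finset.mem_filter] at he
      rw [T_mul_T hT w0 _ e rfl (hinv w0 e hw0 rfl he.2), coef_T, if_neg]
      exact fun h => hne (huniq w0 e hw0 rfl he.2 h)
    · intro h
      exact absurd (Finset.mem_filter.2 ⟨Finset.mem_univ _, isShuffle_one mu β⟩) h
  · intro w hw hne
    rw [Finset.mem_filter] at hw
    rw [Finset.mul_sum, map_sum]
    refine Finset.sum_eq_zero fun e he => ?_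
    rw [Finset.mem_filter] at he
    by_cases hc : content (rowFn mu) (word lam w) = content (rowFn mu) (word lam w0)
    · rw [T_mul_T hT w _ e rfl (hinv w e hw.2 hc he.2), coef_T, if_neg]
      intro h
      have h1 := huniq w e hw.2 hc he.2 h
      rw [h1, one_mul] at h
      exact hne h
    · refine coef_mul_T_eq_zero hT hmu
        (fun x => content (rowFn mu) (word lam x) = content (rowFn mu) (word lam w0))
        ?_ he.2.1 ?_ w0 rfl
      · intro j hj hrow x hx
        rw [content_word_mul lam (rowFn mu) _ x (block_adjT (β := rowFn mu) hj hrow), hx]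
      · intro x hx
        rw [coef_T, if_neg]
        rintro rfl
        exact hc hx
  · intro h
    exact absurd (Finset.mem_filter.2 ⟨Finset.mem_univ _, hw0⟩) h

theorem exists_content_eq_of_coef_ne_zero (hT : IsHeckeBasis q T) {mu lam : ℕ → ℕ}
    (hmu : IsComposition n mu) {β : Fin n → ℕ} (S : Equiv.Perm (Fin n) → Prop)
    (w : Equiv.Perm (Fin n))
    (hw : hT.coef w ((∑ w ∈ Finset.univ.filter S, T w) *
      ∑ e ∈ Finset.univ.filter (IsShuffle mu β), T e) ≠ 0) :
    ∃ w1, S w1 ∧ content (rowFn mu) (word lam w) = content (rowFn mu) (word lam w1) := by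
  by_contra hcon
  refine hw ?_
  rw [Finset.mul_sum, map_sum]
  refine Finset.sum_eq_zero fun e he => ?_
  rw [Finset.mem_filter] at he
  refine coef_mul_T_eq_zero hT hmu (fun x => ¬ ∃ w1, S w1 ∧
    content (rowFn mu) (word lam x) = content (rowFn mu) (word lam w1)) ?_ he.2.1 ?_ w hcon
  · intro j hj hrow x hx
    rwa [content_word_mul lam (rowFn mu) _ x (block_adjT (β := rowFn mu) hj hrow)]
  · intro x hx
    rw [coef_sum_filter, if_neg]
    exact fun h => hx ⟨x, h, rfl⟩

theorem coef_sum_mul_shuffle_eq_of_word_eq (hT : IsHeckeBasis q T) {mu lam : ℕ → ℕ}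
    (hmu : IsComposition n mu) (hlam : IsComposition n lam) {β : Fin n → ℕ}
    (S : Equiv.Perm (Fin n) → Prop)
    (hS : ∀ w w', word lam w = word lam w' → (S w ↔ S w'))
    (w w' : Equiv.Perm (Fin n)) (hw : word lam w = word lam w') :
    hT.coef w ((∑ w ∈ Finset.univ.filter S, T w) *
      ∑ e ∈ Finset.univ.filter (IsShuffle mu β), T e) =
    hT.coef w' ((∑ w ∈ Finset.univ.filter S, T w) *
      ∑ e ∈ Finset.univ.filter (IsShuffle mu β), T e) := by
  rw [Finset.mul_sum, map_sum, map_sum]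
  refine Finset.sum_congr rfl fun e he => ?_
  rw [Finset.mem_filter] at he
  refine coef_mul_T_eq_of_word_eq hT hmu hlam he.2.1 ?_ w w' hw
  intro x x' hx
  rw [coef_sum_filter, coef_sum_filter]
  simp only [hS x x' hx]

/-- An element with coefficients constant on content classes, times `z`, lies in a submodule as
soon as the class sums that occur do. -/
theorem sum_smul_mul_mem {mu lam : ℕ → ℕ} (c : Equiv.Perm (Fin n) → F) (z : H)
    (V : Submodule F H)
    (hc : ∀ w w', content (rowFn mu) (word lam w) = content (rowFn mu) (word lam w') → c w = c w')
    (hV : ∀ w, c w ≠ 0 → (∑ x ∈ Finset.univ.filter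
      (fun x => content (rowFn mu) (word lam x) = content (rowFn mu) (word lam w)), T x) * z ∈ V) :
    (∑ w, c w • T w) * z ∈ V := by
  rw [← Finset.sum_fiberwise_of_maps_to
    (g := fun w : Equiv.Perm (Fin n) => content (rowFn mu) (word lam w))
    (t := Finset.univ.image fun w : Equiv.Perm (Fin n) => content (rowFn mu) (word lam w))
    (fun w hw => Finset.mem_image_of_mem _ hw), Finset.sum_mul]
  refine Submodule.sum_mem _ fun D hD => ?_
  obtain ⟨w, -, rfl⟩ := Finset.mem_image.1 hD
  have h1 : ∑ x ∈ Finset.univ.filter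
      (fun x => content (rowFn mu) (word lam x) = content (rowFn mu) (word lam w)), c x • T x =
      c w • ∑ x ∈ Finset.univ.filter
      (fun x => content (rowFn mu) (word lam x) = content (rowFn mu) (word lam w)), T x := by
    rw [Finset.smul_sum]
    refine Finset.sum_congr rfl fun x hx => ?_
    rw [hc x w (Finset.mem_filter.1 hx).2]
  rw [h1, smul_mul_assoc]
  by_cases h0 : c w = 0
  · rw [h0, zero_smul]
    exact V.zero_mem
  · exact V.smul_mem _ (hV w h0)

end Shuffles
section Multisets

theorem sum_add_sum_sub (v : ℕ) (S : Multiset ℕ) :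
    S.sum + (S.map (fun x => v - x)).sum = (S.map (fun x => x - v)).sum + v * S.card := by
  induction S using Multiset.induction with
  | empty => simp
  | cons x S ih =>
    simp only [Multiset.sum_cons, Multiset.map_cons, Multiset.card_cons]
    rw [mul_add]
    omega

theorem eq_of_add_eq_add {P Q P' Q' : Multiset ℕ} {v : ℕ} (h : P + Q = P' + Q')
    (hcard : P.card = P'.card) (hP : ∀ x ∈ P, v ≤ x) (hQ : ∀ x ∈ Q, x ≤ v)
    (hP' : ∀ x ∈ P', v ≤ x) (hQ' : ∀ x ∈ Q', x ≤ v) : P = P' := by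
  have key : ∀ P Q : Multiset ℕ, (∀ x ∈ P, v ≤ x) → (∀ x ∈ Q, x ≤ v) →
      P = (P + Q).filter (fun x => v < x) +
        Multiset.replicate (P.card - ((P + Q).filter (fun x => v < x)).card) v := by
    intro P Q hP hQ
    have h1 : Q.filter (fun x => v < x) = 0 :=
      Multiset.filter_eq_nil.2 fun x hx => not_lt.2 (hQ x hx)
    have h2 : P.filter (fun x => ¬ v < x) =
        Multiset.replicate (P.filter (fun x => ¬ v < x)).card v := by
      refine Multiset.eq_replicate.2 ⟨rfl, fun x hx => ?_⟩
      rw [Multiset.mem_filter] at hx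
      have := hP x hx.1
      omega
    have h3 := congrArg Multiset.card (Multiset.filter_add_not (fun x => v < x) P)
    rw [Multiset.card_add] at h3
    rw [Multiset.filter_add, h1, add_zero]
    have h4 : P.card - (P.filter (fun x => v < x)).card =
        (P.filter (fun x => ¬ v < x)).card := by omega
    rw [h4, ← h2, Multiset.filter_add_not]
  rw [key P Q hP hQ, key P' Q' hP' hQ', h, hcard]

/-- Moving from a pair of multisets separated by `v` to another pair with the same union
increases the sum of the lower part. -/
theorem sum_lt_of_add_eq_add {P Q P' Q' : Multiset ℕ} {v : ℕ} (h : P + Q = P' + Q')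
    (hcard : P.card = P'.card) (hP : ∀ x ∈ P, v ≤ x) (hQ : ∀ x ∈ Q, x ≤ v) (hne : P ≠ P') :
    Q.sum < Q'.sum := by
  have hcard' : Q.card = Q'.card := by
    have := congrArg Multiset.card h
    rw [Multiset.card_add, Multiset.card_add] at this
    omega
  have hd := congrArg (fun S => (Multiset.map (fun x => v - x) S).sum) h
  simp only [Multiset.map_add, Multiset.sum_add] at hd
  have hdP : (P.map (fun x => v - x)).sum = 0 := by
    rw [Multiset.sum_eq_zero]
    intro y hy
    obtain ⟨x, hx, rfl⟩ := Multiset.mem_map.1 hy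
    exact Nat.sub_eq_zero_of_le (hP x hx)
  have heQ : (Q.map (fun x => x - v)).sum = 0 := by
    rw [Multiset.sum_eq_zero]
    intro y hy
    obtain ⟨x, hx, rfl⟩ := Multiset.mem_map.1 hy
    exact Nat.sub_eq_zero_of_le (hQ x hx)
  have h1 := sum_add_sum_sub v Q
  have h2 := sum_add_sum_sub v Q'
  rw [hcard'] at h1
  by_contra hcon
  have h3 : (P'.map (fun x => v - x)).sum = 0 := by omega
  have h4 : (Q'.map (fun x => x - v)).sum = 0 := by omega
  rw [Multiset.sum_eq_zero_iff] at h3 h4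
  refine hne (eq_of_add_eq_add h hcard hP hQ (fun x hx => ?_) (fun x hx => ?_))
  · exact Nat.sub_eq_zero_iff_le.1 (h3 _ (Multiset.mem_map_of_mem _ hx))
  · exact Nat.sub_eq_zero_iff_le.1 (h4 _ (Multiset.mem_map_of_mem _ hx))

end Multisets

section Garnir

variable {n : ℕ}

/-- The positions from column `a` of row `r` to the position before column `b` of row `r + 1`. -/
def InBelt (mu : ℕ → ℕ) (r a b : ℕ) (k : Fin n) : Prop :=
  cumSum mu r + a ≤ k ∧ (k : ℕ) < cumSum mu (r + 1) + b

/-- The block function whose fibres are the Garnir belt and the remaining parts of the rows. -/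
def beltFn (mu : ℕ → ℕ) (r a b : ℕ) : Fin n → ℕ :=
  fun k => if InBelt mu r a b k then 2 * r + 1 else 2 * rowFn mu k

/-- The multiset of letters of `f` at the positions satisfying `p`. -/
def part (f : Fin n → ℕ) (p : Fin n → Prop) : Multiset ℕ := (Finset.univ.filter p).val.map f

theorem mem_part {f : Fin n → ℕ} {p : Fin n → Prop} {x : ℕ} :
    x ∈ part f p ↔ ∃ k, p k ∧ f k = x := by
  simp [part]

theorem content_eq_part (β f : Fin n → ℕ) (t : ℕ) : content β f t = part f (fun k => β k = t) := by
  unfold content part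
  congr

theorem part_congr (f : Fin n → ℕ) {p p' : Fin n → Prop} (h : ∀ k, p k ↔ p' k) :
    part f p = part f p' := by
  rw [show p = p' from funext fun k => propext (h k)]

theorem part_split (f : Fin n → ℕ) (p s : Fin n → Prop) :
    part f p = part f (fun k => p k ∧ s k) + part f (fun k => p k ∧ ¬ s k) := by
  unfold part
  rw [← Multiset.map_add, Finset.filter_val, Finset.filter_val, Finset.filter_val,
    ← Multiset.filter_add_not s (Multiset.filter p _), Multiset.filter_filter,
    Multiset.filter_filter]
  simp only [and_comm]
  congr!

variable {mu : ℕ → ℕ} {r a b : ℕ}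

theorem InBelt.row (hmu : IsComposition n mu) (hb : b ≤ mu (r + 1)) {k : Fin n}
    (hk : InBelt mu r a b k) : rowFn mu k = r ∨ rowFn mu k = r + 1 := by
  unfold InBelt at hk
  rw [rowFn, rowOf_eq_iff hmu k.2, rowOf_eq_iff hmu k.2, cumSum_succ mu (r + 1)]
  omega

theorem beltFn_eq_odd (k : Fin n) :
    beltFn mu r a b k = 2 * r + 1 ↔ InBelt mu r a b k := by
  unfold beltFn
  split_ifs with h
  · exact iff_of_true rfl h
  · exact iff_of_false (by omega) h

theorem beltFn_eq_even (k : Fin n) (t : ℕ) :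
    beltFn mu r a b k = 2 * t ↔ rowFn mu k = t ∧ ¬ InBelt mu r a b k := by
  unfold beltFn
  split_ifs with h <;> simp only [h, not_true_eq_false, and_false, iff_false, not_false_eq_true,
    and_true]
  · omega
  · omega

theorem beltFn_monotone (hmu : IsComposition n mu) (ha : a ≤ mu r) :
    Monotone (beltFn (n := n) mu r a b) := by
  intro k l hkl
  have hkl' := Fin.le_def.1 hkl
  have h1 : rowFn mu k ≤ rowFn mu l := rowOf_mono hmu hkl' l.2
  have hk : cumSum mu (rowFn mu k) ≤ k ∧ (k : ℕ) < cumSum mu (rowFn mu k + 1) :=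
    rowOf_spec hmu k.2
  have hl : cumSum mu (rowFn mu l) ≤ l ∧ (l : ℕ) < cumSum mu (rowFn mu l + 1) :=
    rowOf_spec hmu l.2
  have h2 := cumSum_succ mu r
  unfold beltFn InBelt
  split_ifs with h3 h4 h4
  · omega
  · have : r < rowFn mu l := by
      by_contra hcon
      have := cumSum_mono mu (show rowFn mu l + 1 ≤ r + 1 by omega)
      omega
    omega
  · have : rowFn mu k ≤ r := by
      by_contra hcon
      have h5 := cumSum_mono mu (show r + 1 ≤ rowFn mu k by omega)
      omega
    omega
  · omega

theorem content_row_eq (f : Fin n → ℕ) (t : ℕ) :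
    content (rowFn mu) f t = part f (fun k => rowFn mu k = t ∧ InBelt mu r a b k) +
      content (beltFn mu r a b) f (2 * t) := by
  rw [content_eq_part, content_eq_part, part_split f _ (InBelt mu r a b)]
  congr 1
  exact part_congr f fun k => (beltFn_eq_even k t).symm

theorem content_belt_eq (hmu : IsComposition n mu) (hb : b ≤ mu (r + 1)) (f : Fin n → ℕ) :
    content (beltFn mu r a b) f (2 * r + 1) =
      part f (fun k => rowFn mu k = r ∧ InBelt mu r a b k) +
      part f (fun k => rowFn mu k = r + 1 ∧ InBelt mu r a b k) := by
  rw [content_eq_part, part_split f _ (fun k => rowFn mu k = r)]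
  congr 1
  · refine part_congr f fun k => ?_
    rw [beltFn_eq_odd, and_comm]
  · refine part_congr f fun k => ?_
    rw [beltFn_eq_odd]
    constructor
    · rintro ⟨h1, h2⟩
      exact ⟨(h1.row hmu hb).resolve_left h2, h1⟩
    · rintro ⟨h1, h2⟩
      exact ⟨h2, by omega⟩

theorem content_row_eq_of_ne (hmu : IsComposition n mu) (hb : b ≤ mu (r + 1)) (f : Fin n → ℕ)
    {t : ℕ} (h1 : t ≠ r) (h2 : t ≠ r + 1) :
    content (rowFn mu) f t = content (beltFn mu r a b) f (2 * t) := by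
  rw [content_row_eq (r := r) (a := a) (b := b)]
  have : part f (fun k => rowFn mu k = t ∧ InBelt mu r a b k) = 0 := by
    refine Multiset.eq_zero_of_forall_notMem fun x hx => ?_
    obtain ⟨k, ⟨hk1, hk2⟩, -⟩ := mem_part.1 hx
    have := hk2.row hmu hb
    omega
  rw [this, zero_add]

/-- In the word `f`, the belt separates the letters of row `r` from below and those of row `r + 1`
from above at the value `v`. -/
def Separated (mu : ℕ → ℕ) (r a b v : ℕ) (f : Fin n → ℕ) : Prop :=
  (∀ k, rowFn mu k = r → (InBelt mu r a b k ↔ v ≤ f k)) ∧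
    ∀ k, rowFn mu k = r + 1 → (InBelt mu r a b k ↔ f k ≤ v)

theorem Separated.transfer {v : ℕ} {f g : Fin n → ℕ} (hg : Separated mu r a b v g)
    (h1 : content (beltFn mu r a b) f = content (beltFn mu r a b) g)
    (h2 : content (rowFn mu) f = content (rowFn mu) g) : Separated mu r a b v f := by
  have key : ∀ t k, rowFn mu k = t → ∃ k', rowFn mu k' = t ∧ g k' = f k ∧
      (InBelt mu r a b k ↔ InBelt mu r a b k') := by
    intro t k hk
    by_cases hm : InBelt mu r a b k
    · have h3 := congrFun h2 t
      rw [content_row_eq (r := r) (a := a) (b := b),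
        content_row_eq (r := r) (a := a) (b := b), congrFun h1, add_left_inj] at h3
      have h4 : f k ∈ part f (fun k => rowFn mu k = t ∧ InBelt mu r a b k) :=
        mem_part.2 ⟨k, ⟨hk, hm⟩, rfl⟩
      rw [h3, mem_part] at h4
      obtain ⟨k', ⟨h5, h6⟩, h7⟩ := h4
      exact ⟨k', h5, h7, iff_of_true hm h6⟩
    · have h4 : f k ∈ content (beltFn mu r a b) f (2 * t) :=
        mem_content.2 ⟨k, (beltFn_eq_even k t).2 ⟨hk, hm⟩, rfl⟩
      rw [h1, mem_content] at h4
      obtain ⟨k', h5, h7⟩ := h4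
      rw [beltFn_eq_even] at h5
      exact ⟨k', h5.1, h7, iff_of_false hm h5.2⟩
  refine ⟨fun k hk => ?_, fun k hk => ?_⟩
  · obtain ⟨k', h3, h4, h5⟩ := key r k hk
    rw [h5, hg.1 k' h3, h4]
  · obtain ⟨k', h3, h4, h5⟩ := key (r + 1) k hk
    rw [h5, hg.2 k' h3, h4]

/-- A statistic on row contents which decreases under Garnir straightening. -/
def rowWeight (N : ℕ) (C : ℕ → Multiset ℕ) : ℕ := ∑ t ∈ Finset.range N, (N - t) * (C t).sum

theorem rowWeight_lt (hmu : IsComposition n mu) (hb : b ≤ mu (r + 1)) {v N : ℕ} (hN : r + 1 < N)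
    {f g : Fin n → ℕ} (hg : Separated mu r a b v g)
    (h1 : content (beltFn mu r a b) f = content (beltFn mu r a b) g)
    (h2 : content (rowFn mu) f ≠ content (rowFn mu) g) :
    rowWeight N (content (rowFn mu) f) < rowWeight N (content (rowFn mu) g) := by
  have hadd : part g (fun k => rowFn mu k = r ∧ InBelt mu r a b k) +
        part g (fun k => rowFn mu k = r + 1 ∧ InBelt mu r a b k) =
      part f (fun k => rowFn mu k = r ∧ InBelt mu r a b k) +
        part f (fun k => rowFn mu k = r + 1 ∧ InBelt mu r a b k) := by
    rw [← content_belt_eq hmu hb, ← content_belt_eq hmu hb, h1]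
  have hfr := content_row_eq (mu := mu) (r := r) (a := a) (b := b) f r
  have hgr := content_row_eq (mu := mu) (r := r) (a := a) (b := b) g r
  have hfs := content_row_eq (mu := mu) (r := r) (a := a) (b := b) f (r + 1)
  have hgs := content_row_eq (mu := mu) (r := r) (a := a) (b := b) g (r + 1)
  rw [h1] at hfr hfs
  have hrest : ∀ t, t ≠ r → t ≠ r + 1 → content (rowFn mu) f t = content (rowFn mu) g t := by
    intro t ht1 ht2
    rw [content_row_eq_of_ne hmu hb f ht1 ht2, content_row_eq_of_ne hmu hb g ht1 ht2, h1]
  have hlt : (part g (fun k => rowFn mu k = r + 1 ∧ InBelt mu r a b k)).sum <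
      (part f (fun k => rowFn mu k = r + 1 ∧ InBelt mu r a b k)).sum := by
    refine sum_lt_of_add_eq_add (v := v) hadd ?_ ?_ ?_ ?_
    · simp only [part, Multiset.card_map]
    · intro x hx
      obtain ⟨k, ⟨hk1, hk2⟩, rfl⟩ := mem_part.1 hx
      exact (hg.1 k hk1).1 hk2
    · intro x hx
      obtain ⟨k, ⟨hk1, hk2⟩, rfl⟩ := mem_part.1 hx
      exact (hg.2 k hk1).1 hk2
    · intro heq
      rw [heq, add_right_inj] at hadd
      refine h2 (funext fun t => ?_)
      by_cases ht1 : t = r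
      · rw [ht1, hfr, hgr, heq]
      by_cases ht2 : t = r + 1
      · rw [ht2, hfs, hgs, hadd]
      exact hrest t ht1 ht2
  have hsum := congrArg Multiset.sum hadd
  rw [Multiset.sum_add, Multiset.sum_add] at hsum
  have hr : r ∈ Finset.range N := Finset.mem_range.2 (by omega)
  have hs : r + 1 ∈ (Finset.range N).erase r :=
    Finset.mem_erase.2 ⟨by omega, Finset.mem_range.2 hN⟩
  unfold rowWeight
  rw [← Finset.add_sum_erase _ _ hr, ← Finset.add_sum_erase _ _ hs,
    ← Finset.add_sum_erase _ _ hr, ← Finset.add_sum_erase _ _ hs]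
  have heq : ∑ t ∈ ((Finset.range N).erase r).erase (r + 1),
        (N - t) * (content (rowFn mu) f t).sum =
      ∑ t ∈ ((Finset.range N).erase r).erase (r + 1),
        (N - t) * (content (rowFn mu) g t).sum := by
    refine Finset.sum_congr rfl fun t ht => ?_
    rw [Finset.mem_erase, Finset.mem_erase] at ht
    rw [hrest t ht.2.1 ht.1]
  rw [heq, hfr, hfs, hgr, hgs]
  simp only [Multiset.sum_add]
  obtain ⟨k, rfl⟩ : ∃ k, N = r + 1 + k := ⟨N - (r + 1), by omega⟩
  rw [show r + 1 + k - r = k + 1 by omega, show r + 1 + k - (r + 1) = k by omega]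
  have hmul := congrArg (k * ·) hsum
  nlinarith

end Garnir
section Straightening

variable {F : Type*} [Field F] {H : Type*} [Ring H] [Algebra F H] {n : ℕ}
  {q : F} {T : Equiv.Perm (Fin n) → H}

theorem Separated.one_of_mul_eq {mu lam : ℕ → ℕ} {r a b v : ℕ} (hmu : IsComposition n mu)
    (ha : a ≤ mu r) (hb : b ≤ mu (r + 1)) {w w0 e : Equiv.Perm (Fin n)}
    (h0 : Separated mu r a b v (word lam w0)) (hw : Separated mu r a b v (word lam w))
    (he : IsShuffle mu (beltFn mu r a b) e) (hew : e * w = w0) : e = 1 := by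
  have hword : ∀ k, word lam w k = word lam w0 (e k) := by
    intro k
    rw [← hew, word_mul, Function.comp_apply, perm_inv_apply]
  have hrow : ∀ k, rowFn mu (e k) = rowFn mu k := fun k => he.1 k
  have hbelt : ∀ k, InBelt mu r a b (e k) ↔ InBelt mu r a b k := by
    intro k
    by_cases h1 : rowFn mu k = r
    · rw [h0.1 _ ((hrow k).trans h1), hw.1 k h1, hword]
    by_cases h2 : rowFn mu k = r + 1
    · rw [h0.2 _ ((hrow k).trans h2), hw.2 k h2, hword]
    refine iff_of_false (fun h => ?_) (fun h => ?_)
    · have := h.row hmu hb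
      rw [hrow] at this
      omega
    · have := h.row hmu hb
      omega
  have hβ : ∀ k, beltFn mu r a b (e k) = beltFn mu r a b k := by
    intro k
    unfold beltFn
    rw [hrow]
    simp only [hbelt]
  refine eq_one_of_forall_lt e fun i hi => ?_
  have hlt : (⟨i, Nat.lt_of_succ_lt hi⟩ : Fin n) < ⟨i + 1, hi⟩ := Fin.lt_def.2 (Nat.lt_succ_self i)
  have h1 : rowFn mu (⟨i, Nat.lt_of_succ_lt hi⟩ : Fin n) ≤ rowFn mu (⟨i + 1, hi⟩ : Fin n) :=
    rowOf_mono hmu (Nat.le_succ i) hi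
  have h2 := beltFn_monotone (r := r) (a := a) (b := b) hmu ha hlt.le
  by_contra hcon
  have h3 := not_lt.1 hcon
  have h4 : rowFn mu (e ⟨i + 1, hi⟩) ≤ rowFn mu (e ⟨i, Nat.lt_of_succ_lt hi⟩) :=
    rowOf_mono hmu (Fin.le_def.1 h3) (Fin.is_lt _)
  have h5 := beltFn_monotone (r := r) (a := a) (b := b) hmu ha h3
  rw [hrow, hrow] at h4
  rw [hβ, hβ] at h5
  exact hcon (he.2 _ _ hlt (le_antisymm h1 h4) (le_antisymm h2 h5))

theorem Separated.inv_lt {mu lam : ℕ → ℕ} {r a b v : ℕ} (hmu : IsComposition n mu)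
    (hlam : IsComposition n lam) (ha : a ≤ mu r) (hb : b ≤ mu (r + 1))
    {w e : Equiv.Perm (Fin n)} (hw : Separated mu r a b v (word lam w))
    (he : IsShuffle mu (beltFn mu r a b) e) {i j : Fin n} (hij : i < j) (hji : e j < e i) :
    w⁻¹ i < w⁻¹ j := by
  have h1 : rowFn mu i ≤ rowFn mu j := rowOf_mono hmu (Fin.le_def.1 hij.le) j.2
  have h2 : rowFn mu (e j) ≤ rowFn mu (e i) := rowOf_mono hmu (Fin.le_def.1 hji.le) (e i).2
  have hrow : ∀ k, rowFn mu (e k) = rowFn mu k := fun k => he.1 k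
  rw [hrow, hrow] at h2
  have hr : rowFn mu i = rowFn mu j := le_antisymm h1 h2
  have hne : beltFn mu r a b i ≠ beltFn mu r a b j :=
    fun h => lt_asymm hji (he.2 i j hij hr h)
  have hor : (InBelt mu r a b i ∧ ¬ InBelt mu r a b j) ∨
      (¬ InBelt mu r a b i ∧ InBelt mu r a b j) := by
    by_cases hi : InBelt mu r a b i <;> by_cases hj : InBelt mu r a b j
    · exact absurd (by simp only [beltFn, hi, hj, if_true]) hne
    · exact Or.inl ⟨hi, hj⟩
    · exact Or.inr ⟨hi, hj⟩
    · exact absurd (by simp only [beltFn, hi, hj, if_false, hr]) hne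
  have hij' := Fin.lt_def.1 hij
  have hj0 : cumSum mu (rowFn mu j) ≤ j ∧ (j : ℕ) < cumSum mu (rowFn mu j + 1) :=
    rowOf_spec hmu j.2
  have hi0 : cumSum mu (rowFn mu i) ≤ i ∧ (i : ℕ) < cumSum mu (rowFn mu i + 1) :=
    rowOf_spec hmu i.2
  have hcs := cumSum_succ mu r
  apply inv_lt_of_word_lt hlam
  have hjr : rowFn mu j = r ∨ rowFn mu j = r + 1 := by
    rcases hor with h | h
    · exact hr ▸ h.1.row hmu hb
    · exact h.2.row hmu hb
  rcases hjr with hjr | hjr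
  · have hi1 := hw.1 i (hr.trans hjr)
    have hj1 := hw.1 j hjr
    rw [hr, hjr] at hi0
    rw [hjr] at hj0
    unfold InBelt at *
    omega
  · have hi1 := hw.2 i (hr.trans hjr)
    have hj1 := hw.2 j hjr
    rw [hr, hjr] at hi0
    rw [hjr] at hj0
    unfold InBelt at *
    omega

theorem sum_belt_mul_eq_zero (hT : IsHeckeBasis q T) (hq : q ≠ 0) {mu lam : ℕ → ℕ}
    (hmu : IsPartition n mu) {r a b : ℕ} (ha : a ≤ mu r) (hab : a < b) (hb : b ≤ mu (r + 1))
    (w0 : Equiv.Perm (Fin n)) (x : H) :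
    (∑ w ∈ Finset.univ.filter (fun w => content (beltFn mu r a b) (word lam w) =
      content (beltFn mu r a b) (word lam w0)), T w) * (x * yElt q T (conjP mu)) = 0 := by
  let P : Finset (Fin n) := Finset.univ.filter (fun k => rowFn mu k < r ∨ InBelt mu r a b k)
  have hle := hmu.1.cumSum_le (r + 1 + 1)
  have hs1 := cumSum_succ mu r
  have hs2 := cumSum_succ mu (r + 1)
  have hcard : P.card = cumSum mu r + (cumSum mu (r + 1) + b - (cumSum mu r + a)) := by
    have h1 : P = Finset.univ.filter (fun p : Fin n => 0 ≤ (p : ℕ) ∧ (p : ℕ) < cumSum mu r) ∪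
        Finset.univ.filter (fun p : Fin n => cumSum mu r + a ≤ (p : ℕ) ∧
          (p : ℕ) < cumSum mu (r + 1) + b) := by
      ext k
      rw [Finset.mem_union, Finset.mem_filter, Finset.mem_filter, Finset.mem_filter]
      have h2 : rowFn mu k < r ↔ (k : ℕ) < cumSum mu r := by
        have hk : cumSum mu (rowFn mu k) ≤ k ∧ (k : ℕ) < cumSum mu (rowFn mu k + 1) :=
          rowOf_spec hmu.1 k.2
        constructor
        · intro h
          have := cumSum_mono mu (show rowFn mu k + 1 ≤ r by omega)
          omega
        · intro h
          by_contra hcon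
          have := cumSum_mono mu (not_lt.1 hcon)
          omega
      rw [h2]
      simp [InBelt]
    rw [h1, Finset.card_union_of_disjoint, card_interval (by omega), card_interval (by omega)]
    · omega
    · rw [Finset.disjoint_left]
      intro k hk hk'
      rw [Finset.mem_filter] at hk hk'
      omega
  refine sum_mul_mul_yElt_eq_zero hT hq hmu (beltFn mu r a b) (beltFn_monotone hmu.1 ha) P (r + 1)
    ?_ (by omega) _ ?_ x
  · have hsub : P.image (beltFn mu r a b) ⊆
        insert (2 * r + 1) ((Finset.range r).image (2 * ·)) := by
      intro t ht
      obtain ⟨k, hk, rfl⟩ := Finset.mem_image.1 ht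
      rw [Finset.mem_filter] at hk
      rw [Finset.mem_insert, Finset.mem_image]
      by_cases h : InBelt mu r a b k
      · exact Or.inl ((beltFn_eq_odd k).2 h)
      · exact Or.inr ⟨rowFn mu k, Finset.mem_range.2 (hk.2.resolve_right h),
          ((beltFn_eq_even k _).2 ⟨rfl, h⟩).symm⟩
    refine (Finset.card_le_card hsub).trans ((Finset.card_insert_le _ _).trans ?_)
    have := Finset.card_image_le (s := Finset.range r) (f := (2 * ·))
    rw [Finset.card_range] at this
    omega
  · intro k hk h w hw
    rw [content_word_mul lam _ _ w (block_adjT hk h), hw]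

/-- One step of Garnir straightening. -/
theorem garnir_step (hT : IsHeckeBasis q T) (hq : q ≠ 0) {mu lam : ℕ → ℕ}
    (hmu : IsPartition n mu) (hlam : IsComposition n lam)
    {r a b v : ℕ} (ha : a ≤ mu r) (hab : a < b) (hb : b ≤ mu (r + 1))
    {w0 : Equiv.Perm (Fin n)} (h0 : Separated mu r a b v (word lam w0)) (x : H)
    (V : Submodule F H)
    (hV : ∀ w1 : Equiv.Perm (Fin n), content (beltFn mu r a b) (word lam w1) =
        content (beltFn mu r a b) (word lam w0) →
      content (rowFn mu) (word lam w1) ≠ content (rowFn mu) (word lam w0) →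
      (∑ w ∈ Finset.univ.filter (fun w => content (rowFn mu) (word lam w) =
        content (rowFn mu) (word lam w1)), T w) * (x * yElt q T (conjP mu)) ∈ V) :
    (∑ w ∈ Finset.univ.filter (fun w => content (rowFn mu) (word lam w) =
      content (rowFn mu) (word lam w0)), T w) * (x * yElt q T (conjP mu)) ∈ V := by
  let S : Equiv.Perm (Fin n) → Prop := fun w => content (beltFn mu r a b) (word lam w) =
    content (beltFn mu r a b) (word lam w0)
  let E : H := ∑ e ∈ Finset.univ.filter (IsShuffle mu (beltFn mu r a b)), T e
  let G : H := (∑ w ∈ Finset.univ.filter S, T w) * E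
  have hGz : G * (x * yElt q T (conjP mu)) = 0 := by
    have := sum_belt_mul_eq_zero (lam := lam) hT hq hmu ha hab hb w0 (E * x)
    rw [mul_assoc E] at this
    rw [mul_assoc]
    exact this
  have hGT : ∀ j (hj : j + 1 < n), rowOf mu j = rowOf mu (j + 1) →
      G * T (adjT j hj) = q • G := fun j hj hrow =>
    sum_mul_shuffle_mul_adj hT hmu.1 (beltFn_monotone hmu.1 ha) S
      (fun k hk h w hw => (content_word_mul lam _ _ w (block_adjT hk h)).trans hw) hj hrow
  have hGw : ∀ w w', content (rowFn mu) (word lam w) = content (rowFn mu) (word lam w') →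
      hT.coef w G = hT.coef w' G :=
    coef_eq_of_content_eq hT hq hmu.1 hGT fun w w' h =>
      coef_sum_mul_shuffle_eq_of_word_eq hT hmu.1 hlam S (fun x x' hx => by simp only [S, hx])
        w w' h
  have hG0 : hT.coef w0 G = 1 :=
    coef_sum_mul_shuffle_eq_one (lam := lam) hT hmu.1 S rfl
      (fun w e hw hc he i j hij hji =>
        (h0.transfer hw hc).inv_lt hmu.1 hlam ha hb he hij hji)
      (fun w e hw hc he h => h0.one_of_mul_eq hmu.1 ha hb (h0.transfer hw hc) he h)
  have hG1 : ∀ w, hT.coef w G ≠ 0 → ∃ w1, S w1 ∧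
      content (rowFn mu) (word lam w) = content (rowFn mu) (word lam w1) :=
    fun w hw => exists_content_eq_of_coef_ne_zero hT hmu.1 S w hw
  have hdecomp : G = (∑ w ∈ Finset.univ.filter (fun w => content (rowFn mu) (word lam w) =
      content (rowFn mu) (word lam w0)), T w) +
      ∑ w, (if content (rowFn mu) (word lam w) = content (rowFn mu) (word lam w0) then 0
        else hT.coef w G) • T w := by
    conv_lhs => rw [← sum_coef hT G]
    rw [Finset.sum_filter, ← Finset.sum_add_distrib]
    refine Finset.sum_congr rfl fun w _ => ?_
    split_ifs with hc
    · rw [hGw w w0 hc, hG0, one_smul, zero_smul, add_zero]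
    · rw [zero_add]
  rw [hdecomp, add_mul] at hGz
  rw [eq_neg_of_add_eq_zero_left hGz]
  refine V.neg_mem (sum_smul_mul_mem (mu := mu) (lam := lam) _ _ V ?_ ?_)
  · intro w w' hc
    simp only [hc, hGw w w' hc]
  · intro w hw
    split_ifs at hw with hc
    · exact absurd rfl hw
    · obtain ⟨w1, hw1, hc1⟩ := hG1 w hw
      simp only [hc1]
      exact hV w1 hw1 (hc1 ▸ hc)

/-- A row-standard tableau that is not semistandard has a Garnir belt. -/
theorem exists_separated {mu : ℕ → ℕ} (hmu : IsPartition n mu) {C : ℕ → Multiset ℕ}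
    (hC : RowsOfShape mu C) (hns : ¬ Semistandard mu C) :
    ∃ r a b v, a ≤ mu r ∧ a < b ∧ b ≤ mu (r + 1) ∧
      Separated mu r a b v (reading (m := n) mu C) := by
  unfold Semistandard at hns
  push Not at hns
  obtain ⟨r, c, hc, hle⟩ := hns
  have hanti : mu (r + 1) ≤ mu r := hmu.2 (Nat.le_succ r)
  generalize hv : entryAt C r c = v at hle
  obtain ⟨a, hlo⟩ : ∃ a, ∀ i, i < mu r → (entryAt C r i < v ↔ i < a) := by
    rw [← hC r]
    exact ⟨_, entryAt_iff (· < v) (fun x y h1 h2 => lt_of_le_of_lt h1 h2) C r⟩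
  obtain ⟨b, hhi, hble⟩ : ∃ b, (∀ i, i < mu (r + 1) → (entryAt C (r + 1) i ≤ v ↔ i < b)) ∧
      b ≤ mu (r + 1) := by
    rw [← hC (r + 1)]
    refine ⟨_, entryAt_iff (· ≤ v) (fun x y h1 h2 => le_trans h1 h2) C (r + 1), ?_⟩
    refine List.countP_le_length.trans ?_
    rw [Multiset.length_sort]
  have h1 := hlo c (by omega)
  have h2 := hhi c hc
  refine ⟨r, a, b, v, by omega, by omega, hble, fun k hk => ?_, fun k hk => ?_⟩
  · have hk' : rowOf mu k = r := hk
    have h3 := (rowOf_eq_iff hmu.1 k.2).1 hk'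
    have h4 := cumSum_succ mu r
    have h5 := hlo (k - cumSum mu r) (by omega)
    rw [reading, hk']
    unfold InBelt
    omega
  · have hk' : rowOf mu k = r + 1 := hk
    have h3 := (rowOf_eq_iff hmu.1 k.2).1 hk'
    have h4 := cumSum_succ mu (r + 1)
    have h6 := cumSum_succ mu r
    have h5 := hhi (k - cumSum mu (r + 1)) (by omega)
    rw [reading, hk']
    unfold InBelt
    omega

theorem content_sum_mul_mem_span (hT : IsHeckeBasis q T) (hq : q ≠ 0) {mu lam : ℕ → ℕ}
    (hmu : IsPartition n mu) (hlam : IsComposition n lam) (x : H) (N : ℕ)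
    (hN : ∀ t, N ≤ t → mu t = 0) (l : ℕ) :
    ∀ w0 : Equiv.Perm (Fin n), rowWeight N (content (rowFn mu) (word lam w0)) = l →
      (∑ w ∈ Finset.univ.filter (fun w => content (rowFn mu) (word lam w) =
        content (rowFn mu) (word lam w0)), T w) * (x * yElt q T (conjP mu)) ∈
      Submodule.span F {h : H | ∃ (B : ℕ → Multiset ℕ) (dB : Equiv.Perm (Fin n)),
        RowsOfShape mu B ∧ HasType B lam ∧ Semistandard mu B ∧ Is1A mu lam B dB ∧
        h = XPhi T lam mu dB * (x * yElt q T (conjP mu))} := by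
  induction l using Nat.strong_induction_on with
  | _ l ih =>
    intro w0 hl
    obtain ⟨d, hd⟩ := exists_is1A hmu.1 hlam w0
    have hshape := card_content hmu.1 (word lam w0)
    have hword := word_eq_reading_of_is1A hd
    have hcd : content (rowFn mu) (word lam d) = content (rowFn mu) (word lam w0) := by
      rw [hword, content_reading hmu.1 _ hshape]
    by_cases hss : Semistandard mu (content (rowFn mu) (word lam w0))
    · refine Submodule.subset_span ⟨_, d, hshape, hasType_content_word hlam mu w0, hss, hd, ?_⟩
      simp only [XPhi, mem_doubleCoset_iff, hcd]
    · obtain ⟨r, a, b, v, ha, hab, hb, hsep⟩ := exists_separated hmu hshape hss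
      rw [← hword] at hsep
      have hrN : r + 1 < N := by
        by_contra hcon
        have := hN (r + 1) (not_lt.1 hcon)
        omega
      rw [← hcd]
      refine garnir_step hT hq hmu hlam ha hab hb hsep x _ fun w1 hw1 hne => ?_
      refine ih _ ?_ w1 rfl
      rw [← hl, ← hcd]
      exact rowWeight_lt hmu.1 hb hrN hsep hw1 hne

end Straightening

/-- for `μ ⊢ n`, `λ ⊨ n` and a row-standard `μ`-tableau `A` of type
`λ`, the homomorphism `φ̂_A : S^μ → M^λ` lies in the `F`-span of the semistandard
homomorphisms `φ̂_B`.  Since such a homomorphism is determined by the image of the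
generator `z_μ = x_μ T_{w_μ} y_{μ'}` of `S^μ`, and `φ̂_C(z_μ) = (x_μ φ_C) T_{w_μ} y_{μ'}`,
this says exactly that `(x_μ φ_A) T_{w_μ} y_{μ'}` lies in the `F`-span of the elements
`(x_μ φ_B) T_{w_μ} y_{μ'}` for `B` a semistandard `μ`-tableau of type `λ`. -/
theorem semistandard_span
    {F : Type*} [Field F] {H : Type*} [Ring H] [Algebra F H]
    {n : ℕ} (q : F) (hq : q ≠ 0)
    (mu lam : ℕ → ℕ) (hmu : IsPartition n mu) (hlam : IsComposition n lam)
    (T : Equiv.Perm (Fin n) → H) (hT : IsHeckeBasis q T)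
    (wmu : Equiv.Perm (Fin n)) (hwmu : IsWmu mu wmu)
    (A : ℕ → Multiset ℕ) (hshape : RowsOfShape mu A) (htype : HasType A lam)
    (dA : Equiv.Perm (Fin n)) (hdA : Is1A mu lam A dA) :
    XPhi T lam mu dA * (T wmu * yElt q T (conjP mu)) ∈
      Submodule.span F {h : H | ∃ (B : ℕ → Multiset ℕ) (dB : Equiv.Perm (Fin n)),
        RowsOfShape mu B ∧ HasType B lam ∧ Semistandard mu B ∧ Is1A mu lam B dB ∧
        h = XPhi T lam mu dB * (T wmu * yElt q T (conjP mu))} := by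
  obtain ⟨N, hN, -⟩ := hmu.1
  have h := content_sum_mul_mem_span hT hq hmu hlam (T wmu) N hN _ dA rfl
  simp only [← mem_doubleCoset_iff] at h
  exact h

end FayersSemistd
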